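/- arXiv:1401.8201 — 9 statements merged into one kernel-verified Lean document; each statement's English description precedes it below -/
import Mathlib

section
/- N(π) ≰bool N(⁻¹, di): there exists a boolean query expressible in N(π) that is not expressible in N(⁻¹, di). Concretely, the boolean query Q_ZZZ, which is true on a graph G iff there is a homomorphism from the pattern B_ZZZ into G, is expressed in N(π) by the expression π1(R⁴ ∘ π2(π1(R⁴) ∘ R)) ∘ π1(R⁵ ∘ π2(π1(R⁵) ∘ R)) ∘ π1(R⁶ ∘ π2(π1(R⁶) ∘ R)), but is not expressed by any expression of N(⁻¹, di). -/
namespace NavGraph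

/-- The nonbasic features of the navigational algebra. -/
inductive Feature : Type
  | di | conv | inter | diff | proj | coproj
  deriving DecidableEq

/-- A graph over the label set `Λ`: it assigns to each label a binary relation
on the infinite universe of nodes (here `ℕ`). -/
def Graph (Λ : Type) : Type := Λ → Set (ℕ × ℕ)

/-- The active domain of a graph. -/
def adom {Λ : Type} (G : Graph Λ) : Set ℕ :=
  {m | ∃ n : ℕ, ∃ R : Λ, (m, n) ∈ G R ∨ (n, m) ∈ G R}

/-- A graph is finite if each of its relations is finite. -/
def Graph.Finite {Λ : Type} (G : Graph Λ) : Prop := ∀ R : Λ, Set.Finite (G R)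

/-- Expressions of the navigational algebra (with all nonbasic features). -/
inductive Expr (Λ : Type) : Type
  | rel (R : Λ)
  | empty
  | id
  | comp (e₁ e₂ : Expr Λ)
  | union (e₁ e₂ : Expr Λ)
  | di
  | conv (e : Expr Λ)
  | inter (e₁ e₂ : Expr Λ)
  | diff (e₁ e₂ : Expr Λ)
  | proj1 (e : Expr Λ)
  | proj2 (e : Expr Λ)
  | coproj1 (e : Expr Λ)
  | coproj2 (e : Expr Λ)

/-- Semantics of expressions on graphs. -/
def eval {Λ : Type} : Expr Λ → Graph Λ → Set (ℕ × ℕ)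
  | .rel R, G => G R
  | .empty, _ => ∅
  | .id, G => {p | p.1 = p.2 ∧ p.1 ∈ adom G}
  | .comp e₁ e₂, G => {p | ∃ z : ℕ, (p.1, z) ∈ eval e₁ G ∧ (z, p.2) ∈ eval e₂ G}
  | .union e₁ e₂, G => eval e₁ G ∪ eval e₂ G
  | .di, G => {p | p.1 ∈ adom G ∧ p.2 ∈ adom G ∧ p.1 ≠ p.2}
  | .conv e, G => {p | (p.2, p.1) ∈ eval e G}
  | .inter e₁ e₂, G => eval e₁ G ∩ eval e₂ G
  | .diff e₁ e₂, G => eval e₁ G \ eval e₂ G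
  | .proj1 e, G => {p | p.1 = p.2 ∧ p.1 ∈ adom G ∧ ∃ n : ℕ, (p.1, n) ∈ eval e G}
  | .proj2 e, G => {p | p.1 = p.2 ∧ p.1 ∈ adom G ∧ ∃ n : ℕ, (n, p.1) ∈ eval e G}
  | .coproj1 e, G => {p | p.1 = p.2 ∧ p.1 ∈ adom G ∧ ¬ ∃ n : ℕ, (p.1, n) ∈ eval e G}
  | .coproj2 e, G => {p | p.1 = p.2 ∧ p.1 ∈ adom G ∧ ¬ ∃ n : ℕ, (n, p.1) ∈ eval e G}

/-- `e.InFrag F` holds if `e` is an expression of the language `N(F)`, i.e. it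
only uses the basic operators and nonbasic features from `F`. -/
def Expr.InFrag {Λ : Type} (F : Set Feature) : Expr Λ → Prop
  | .rel _ => True
  | .empty => True
  | .id => True
  | .comp e₁ e₂ => e₁.InFrag F ∧ e₂.InFrag F
  | .union e₁ e₂ => e₁.InFrag F ∧ e₂.InFrag F
  | .di => Feature.di ∈ F
  | .conv e => Feature.conv ∈ F ∧ e.InFrag F
  | .inter e₁ e₂ => Feature.inter ∈ F ∧ e₁.InFrag F ∧ e₂.InFrag F
  | .diff e₁ e₂ => Feature.diff ∈ F ∧ e₁.InFrag F ∧ e₂.InFrag F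
  | .proj1 e => Feature.proj ∈ F ∧ e.InFrag F
  | .proj2 e => Feature.proj ∈ F ∧ e.InFrag F
  | .coproj1 e => Feature.coproj ∈ F ∧ e.InFrag F
  | .coproj2 e => Feature.coproj ∈ F ∧ e.InFrag F

/-- Membership in the closure `F̄` of a set of nonbasic features. -/
inductive InClosure (F : Set Feature) : Feature → Prop
  | base {x : Feature} : x ∈ F → InClosure F x
  | proj_of_coproj : InClosure F .coproj → InClosure F .proj
  | proj_of_inter_di : InClosure F .inter → InClosure F .di → InClosure F .proj
  | proj_of_inter_conv : InClosure F .inter → InClosure F .conv → InClosure F .proj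
  | coproj_of_diff_proj : InClosure F .diff → InClosure F .proj → InClosure F .coproj
  | inter_of_diff : InClosure F .diff → InClosure F .inter

/-- The closure `F̄` of a set of nonbasic features. -/
def closure (F : Set Feature) : Set Feature := {x | InClosure F x}

open Classical in
/-- The set `F̃`: replace converse by projection when converse is available but
intersection is not. -/
noncomputable def tilde (F : Set Feature) : Set Feature :=
  if Feature.conv ∈ closure F ∧ Feature.inter ∉ closure F then
    (F \ {Feature.conv}) ∪ {Feature.proj}
  else F

/-- `N(F₁) ≤path N(F₂)`: every path query expressible in `N(F₁)` is expressible
in `N(F₂)`. -/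
def leqPath (Λ : Type) (F₁ F₂ : Set Feature) : Prop :=
  ∀ e₁ : Expr Λ, e₁.InFrag F₁ →
    ∃ e₂ : Expr Λ, e₂.InFrag F₂ ∧ ∀ G : Graph Λ, eval e₂ G = eval e₁ G

/-- `N(F₁) ≤bool N(F₂)`: every boolean query expressible in `N(F₁)` is
expressible in `N(F₂)`. -/
def leqBool (Λ : Type) (F₁ F₂ : Set Feature) : Prop :=
  ∀ e₁ : Expr Λ, e₁.InFrag F₁ →
    ∃ e₂ : Expr Λ, e₂.InFrag F₂ ∧
      ∀ G : Graph Λ, ((eval e₂ G).Nonempty ↔ (eval e₁ G).Nonempty)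

/-- Strong separability at the level of boolean queries. -/
def StrongSepBool (Λ : Type) (F₁ F₂ : Set Feature) : Prop :=
  ∃ (e₁ : Expr Λ) (G₁ G₂ : Graph Λ), e₁.InFrag F₁ ∧ G₁.Finite ∧ G₂.Finite ∧
    (eval e₁ G₁).Nonempty ∧ ¬ (eval e₁ G₂).Nonempty ∧
    ∀ e₂ : Expr Λ, e₂.InFrag F₂ → ((eval e₂ G₁).Nonempty ↔ (eval e₂ G₂).Nonempty)

/-- Strong separability at the level of path queries. -/
def StrongSepPath (Λ : Type) (F₁ F₂ : Set Feature) : Prop :=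
  ∃ (e₁ : Expr Λ) (G : Graph Λ), e₁.InFrag F₁ ∧ G.Finite ∧
    ∀ e₂ : Expr Λ, e₂.InFrag F₂ → eval e₂ G ≠ eval e₁ G

/-- The `n`-fold composition `R ∘ ⋯ ∘ R` (with `R⁰ = id`). -/
def rpow {Λ : Type} (R : Λ) : ℕ → Expr Λ
  | 0 => .id
  | n + 1 => .comp (.rel R) (rpow R n)

/-- The degree of an expression: the maximum depth of nested applications of
composition, projection and coprojection. -/
def degree {Λ : Type} : Expr Λ → ℕ
  | .rel _ => 0
  | .empty => 0
  | .id => 0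
  | .di => 0
  | .comp e₁ e₂ => max (degree e₁) (degree e₂) + 1
  | .union e₁ e₂ => max (degree e₁) (degree e₂)
  | .conv e => degree e
  | .inter e₁ e₂ => max (degree e₁) (degree e₂)
  | .diff e₁ e₂ => max (degree e₁) (degree e₂)
  | .proj1 e => degree e + 1
  | .proj2 e => degree e + 1
  | .coproj1 e => degree e + 1
  | .coproj2 e => degree e + 1

end NavGraph

namespace NavGraph

/-- The possible zigzag lengths of the pattern `B_ZZZ`. -/
def zChainPs : Set ℕ := {4, 5, 6}

/-- The nodes of the pattern `B_ZZZ`, encoded as natural numbers: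
`a` is `0`, `x_{p,i}` is `100*p + i` (for `1 ≤ i ≤ p`), and
`y_{p,i}` is `100*p + 50 + i` (for `0 ≤ i ≤ p`), for `p ∈ {4,5,6}`. -/
def zNodes : Set ℕ :=
  {0} ∪ {v | ∃ p ∈ zChainPs,
    (∃ i : ℕ, 1 ≤ i ∧ i ≤ p ∧ v = 100 * p + i) ∨
    (∃ i : ℕ, i ≤ p ∧ v = 100 * p + 50 + i)}

/-- The edges of the pattern `B_ZZZ`: for each `p ∈ {4,5,6}`,
`a → x_{p,1}`; `x_{p,i} → x_{p,i+1}` for `1 ≤ i ≤ p−1`; `y_{p,0} → x_{p,p}`;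
and `y_{p,i} → y_{p,i+1}` for `0 ≤ i ≤ p−1`. -/
def zEdges : Set (ℕ × ℕ) :=
  {e | ∃ p ∈ zChainPs,
    e = (0, 100 * p + 1) ∨
    (∃ i : ℕ, 1 ≤ i ∧ i + 1 ≤ p ∧ e = (100 * p + i, 100 * p + i + 1)) ∨
    e = (100 * p + 50, 100 * p + p) ∨
    (∃ i : ℕ, i + 1 ≤ p ∧ e = (100 * p + 50 + i, 100 * p + 50 + i + 1))}

/-- The boolean query `Q_ZZZ`: true on `G` iff there is a homomorphism from the
pattern `B_ZZZ` into `G` (over the single label `R`, i.e. `Λ = Unit`). -/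
def QZZZ (G : Graph Unit) : Prop :=
  ∃ h : ℕ → ℕ, (∀ v ∈ zNodes, h v ∈ adom G) ∧
    ∀ e ∈ zEdges, (h e.1, h e.2) ∈ G ()

/-- The building block `π1(Rᵖ ∘ π2(π1(Rᵖ) ∘ R))` of the `N(π)` expression. -/
def zExprBlock (p : ℕ) : Expr Unit :=
  .proj1 (.comp (rpow () p) (.proj2 (.comp (.proj1 (rpow () p)) (.rel ()))))

/-- The expression
`π1(R⁴ ∘ π2(π1(R⁴) ∘ R)) ∘ π1(R⁵ ∘ π2(π1(R⁵) ∘ R)) ∘ π1(R⁶ ∘ π2(π1(R⁶) ∘ R))`. -/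
def zExpr : Expr Unit := .comp (zExprBlock 4) (.comp (zExprBlock 5) (zExprBlock 6))

theorem zNodes_subset_adom {G : Graph Unit} {h : ℕ → ℕ}
    (hh : ∀ e ∈ zEdges, (h e.1, h e.2) ∈ G ()) : ∀ v ∈ zNodes, h v ∈ adom G := by
  rintro v (rfl | ⟨p, hp, ⟨i, hi1, hip, rfl⟩ | ⟨i, hip, rfl⟩⟩)
  · exact ⟨_, (), Or.inl (hh (0, 401) ⟨4, by simp [zChainPs], Or.inl rfl⟩)⟩
  · rcases Nat.lt_or_ge 1 i with h1 | h1
    · obtain ⟨j, rfl⟩ : ∃ j, i = j + 1 := ⟨i - 1, by omega⟩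
      exact ⟨_, (), Or.inr (hh _ ⟨p, hp, Or.inr (Or.inl ⟨j, by omega, hip, rfl⟩)⟩)⟩
    · obtain rfl : i = 1 := by omega
      exact ⟨_, (), Or.inr (hh _ ⟨p, hp, Or.inl rfl⟩)⟩
  · rcases i with _ | j
    · exact ⟨_, (), Or.inl (hh _ ⟨p, hp, Or.inr (Or.inr (Or.inl rfl))⟩)⟩
    · exact ⟨_, (), Or.inr (hh _ ⟨p, hp, Or.inr (Or.inr (Or.inr ⟨j, hip, rfl⟩))⟩)⟩

theorem QZZZ_iff {G : Graph Unit} :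
    QZZZ G ↔ ∃ h : ℕ → ℕ, ∀ e ∈ zEdges, (h e.1, h e.2) ∈ G () :=
  ⟨fun ⟨h, _, hh⟩ => ⟨h, hh⟩, fun ⟨h, hh⟩ => ⟨h, zNodes_subset_adom hh, hh⟩⟩

/-- `c 0 → c 1 → ⋯ → c k` is a directed walk in `G`. -/
def IsWalk (G : Graph Unit) (k : ℕ) (c : ℕ → ℕ) : Prop :=
  ∀ i < k, (c i, c (i + 1)) ∈ G ()

theorem mem_eval_rpow {G : Graph Unit} {k u v : ℕ} :
    (u, v) ∈ eval (rpow () k) G ↔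
      v ∈ adom G ∧ ∃ c : ℕ → ℕ, c 0 = u ∧ c k = v ∧ IsWalk G k c := by
  induction k generalizing u with
  | zero =>
    constructor
    · rintro ⟨h1, h2⟩
      simp only at h1 h2
      subst h1
      exact ⟨h2, fun _ => u, rfl, rfl, fun i hi => by omega⟩
    · rintro ⟨hv, c, rfl, rfl, -⟩
      exact ⟨rfl, hv⟩
  | succ k ih =>
    constructor
    · rintro ⟨z, hz, hzv⟩
      obtain ⟨hv, c, rfl, rfl, hc⟩ := ih.1 hzv
      refine ⟨hv, fun i => Nat.casesOn i u c, rfl, rfl, ?_⟩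
      rintro (_ | i) hi
      · exact hz
      · exact hc i (by omega)
    · rintro ⟨hv, c, rfl, rfl, hc⟩
      exact ⟨c 1, hc 0 (by omega),
        ih.2 ⟨hv, fun i => c (i + 1), rfl, rfl, fun i hi => hc (i + 1) (by omega)⟩⟩

/-- `u` is the start of a zigzag of length `p` in `G`. -/
def HasZigzag (G : Graph Unit) (p u : ℕ) : Prop :=
  ∃ c d : ℕ → ℕ, c 0 = u ∧ IsWalk G p c ∧ (d 0, c p) ∈ G () ∧ IsWalk G p d

theorem mem_eval_zExprBlock {G : Graph Unit} {p u v : ℕ} (hp : 0 < p) :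
    (u, v) ∈ eval (zExprBlock p) G ↔ u = v ∧ HasZigzag G p u := by
  constructor
  · rintro ⟨huv, -, n, z, hz, hzn, -, y, y', ⟨hyy, -, n', hy⟩, hyz⟩
    simp only at huv hz hzn hyy hy hyz
    subst huv hzn hyy
    obtain ⟨-, c, rfl, rfl, hc⟩ := mem_eval_rpow.1 hz
    obtain ⟨-, d, rfl, rfl, hd⟩ := mem_eval_rpow.1 hy
    exact ⟨rfl, c, d, rfl, hc, hyz, hd⟩
  · rintro ⟨rfl, c, d, rfl, hc, hdc, hd⟩
    have hcp : c p ∈ adom G := ⟨_, (), Or.inr hdc⟩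
    have hd0 : d 0 ∈ adom G := ⟨_, (), Or.inl hdc⟩
    have hdp : d p ∈ adom G := by
      obtain ⟨q, rfl⟩ : ∃ q, p = q + 1 := ⟨p - 1, by omega⟩
      exact ⟨_, (), Or.inr (hd q (by omega))⟩
    exact ⟨rfl, ⟨_, (), Or.inl (hc 0 hp)⟩, c p, c p, mem_eval_rpow.2 ⟨hcp, c, rfl, rfl, hc⟩,
      rfl, hcp, d 0, d 0, ⟨rfl, hd0, d p, mem_eval_rpow.2 ⟨hdp, d, rfl, rfl, hd⟩⟩, hdc⟩

theorem zExpr_nonempty_iff {G : Graph Unit} :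
    (eval zExpr G).Nonempty ↔ ∃ u, ∀ p ∈ zChainPs, HasZigzag G p u := by
  have h4 : 0 < 4 := by norm_num
  have h5 : 0 < 5 := by norm_num
  have h6 : 0 < 6 := by norm_num
  constructor
  · rintro ⟨⟨u, v⟩, z, hz, w, hw, hv⟩
    simp only [mem_eval_zExprBlock h4, mem_eval_zExprBlock h5,
      mem_eval_zExprBlock h6] at hz hw hv
    obtain ⟨rfl, hz⟩ := hz
    obtain ⟨rfl, hw⟩ := hw
    refine ⟨u, ?_⟩
    rintro p (rfl | rfl | rfl)
    exacts [hz, hw, hv.2]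
  · rintro ⟨u, hu⟩
    exact ⟨(u, u), u, (mem_eval_zExprBlock h4).2 ⟨rfl, hu 4 (by simp [zChainPs])⟩,
      u, (mem_eval_zExprBlock h5).2 ⟨rfl, hu 5 (by simp [zChainPs])⟩,
      (mem_eval_zExprBlock h6).2 ⟨rfl, hu 6 (by simp [zChainPs])⟩⟩

theorem isWalk_zigzag_left {G : Graph Unit} {h : ℕ → ℕ}
    (hh : ∀ e ∈ zEdges, (h e.1, h e.2) ∈ G ()) {p : ℕ} (hp : p ∈ zChainPs) :
    IsWalk G p (fun i => if i = 0 then h 0 else h (100 * p + i)) := by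
  rintro (_ | i) hi
  · exact hh _ ⟨p, hp, Or.inl rfl⟩
  · exact hh _ ⟨p, hp, Or.inr (Or.inl ⟨i + 1, by omega, by omega, rfl⟩)⟩

theorem hasZigzag_of_hom {G : Graph Unit} {h : ℕ → ℕ}
    (hh : ∀ e ∈ zEdges, (h e.1, h e.2) ∈ G ()) {p : ℕ} (hp : p ∈ zChainPs) :
    HasZigzag G p (h 0) := by
  have hp0 : p ≠ 0 := by rintro rfl; simp [zChainPs] at hp
  refine ⟨fun i => if i = 0 then h 0 else h (100 * p + i), fun i => h (100 * p + 50 + i), rfl,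
    isWalk_zigzag_left hh hp, ?_, ?_⟩
  · simpa [hp0] using hh _ ⟨p, hp, Or.inr (Or.inr (Or.inl rfl))⟩
  · intro i hi
    exact hh _ ⟨p, hp, Or.inr (Or.inr (Or.inr ⟨i, hi, rfl⟩))⟩

theorem QZZZ_iff_hasZigzag {G : Graph Unit} :
    QZZZ G ↔ ∃ u, ∀ p ∈ zChainPs, HasZigzag G p u := by
  rw [QZZZ_iff]
  constructor
  · rintro ⟨h, hh⟩
    exact ⟨h 0, fun p hp => hasZigzag_of_hom hh hp⟩
  · rintro ⟨u, hu⟩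
    choose! c d hc0 hc hdc hd using hu
    let h : ℕ → ℕ := fun v =>
      if v = 0 then u
      else if v % 100 < 50 then c (v / 100) (v % 100) else d (v / 100) (v % 100 - 50)
    have hx : ∀ p ∈ zChainPs, ∀ i ≤ p, h (100 * p + i) = c p i := by
      intro p hp i hi
      have hp6 : 4 ≤ p ∧ p ≤ 6 := by rcases hp with rfl | rfl | rfl <;> omega
      have h1 : (100 * p + i) / 100 = p := by omega
      have h2 : (100 * p + i) % 100 = i := by omega
      simp only [h, h1, h2]
      rw [if_neg (by omega), if_pos (by omega)]
    have hy : ∀ p ∈ zChainPs, ∀ i ≤ p, h (100 * p + 50 + i) = d p i := by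
      intro p hp i hi
      have hp6 : 4 ≤ p ∧ p ≤ 6 := by rcases hp with rfl | rfl | rfl <;> omega
      have h1 : (100 * p + 50 + i) / 100 = p := by omega
      have h2 : (100 * p + 50 + i) % 100 = 50 + i := by omega
      simp only [h, h1, h2]
      rw [if_neg (by omega), if_neg (by omega), Nat.add_sub_cancel_left]
    refine ⟨h, ?_⟩
    rintro e ⟨p, hp, he⟩
    have hp4 : 4 ≤ p := by rcases hp with rfl | rfl | rfl <;> omega
    rcases he with rfl | ⟨i, hi1, hip, rfl⟩ | rfl | ⟨i, hip, rfl⟩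
    · have h0 : h 0 = c p 0 := (hc0 p hp).symm
      simpa only [h0, hx p hp 1 (by omega)] using hc p hp 0 (by omega)
    · simpa only [add_assoc, hx p hp i (by omega), hx p hp (i + 1) hip] using hc p hp i hip
    · simpa only [hx p hp p le_rfl, hy p hp 0 (by omega)] using hdc p hp
    · have h1 := hy p hp i (by omega)
      have h2 := hy p hp (i + 1) hip
      rw [← add_assoc] at h2
      simpa only [h1, h2] using hd p hp i hip

/-- The pattern `B_ZZZ` as a graph. -/
def zGraph : Graph Unit := fun _ => zEdges

/-- An upper bound on the length of the directed walks in `B_ZZZ` starting at a node. -/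
def zCoheight (v : ℕ) : ℕ :=
  if v = 0 then 6 else if v % 100 < 50 then v / 100 - v % 100 else v / 100 + 50 - v % 100

/-- An upper bound on the length of the directed walks in `B_ZZZ` ending at a node. -/
def zHeight (v : ℕ) : ℕ :=
  if v = 0 then 0 else if v % 100 < 50 then v % 100 else v % 100 - 50

/-- The edges of `B_ZZZ`, as a list. -/
def zEdgeList : List (ℕ × ℕ) :=
  [4, 5, 6].flatMap fun p =>
    (0, 100 * p + 1) :: (100 * p + 50, 100 * p + p) ::
      ((List.range (p - 1)).map (fun i => (100 * p + (i + 1), 100 * p + (i + 1) + 1)) ++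
        (List.range p).map (fun i => (100 * p + 50 + i, 100 * p + 50 + i + 1)))

theorem mem_zEdgeList {e : ℕ × ℕ} (he : e ∈ zEdges) : e ∈ zEdgeList := by
  obtain ⟨p, hp, he⟩ := he
  have hp' : p ∈ [4, 5, 6] := by simpa [zChainPs] using hp
  refine List.mem_flatMap.2 ⟨p, hp', ?_⟩
  rcases he with rfl | ⟨i, hi1, hip, rfl⟩ | rfl | ⟨i, hip, rfl⟩
  · exact List.mem_cons_self
  · obtain ⟨j, rfl⟩ : ∃ j, i = j + 1 := ⟨i - 1, by omega⟩
    refine List.mem_cons_of_mem _ (List.mem_cons_of_mem _ (List.mem_append_left _ ?_))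
    exact List.mem_map.2 ⟨j, List.mem_range.2 (by omega), rfl⟩
  · exact List.mem_cons_of_mem _ List.mem_cons_self
  · refine List.mem_cons_of_mem _ (List.mem_cons_of_mem _ (List.mem_append_right _ ?_))
    exact List.mem_map.2 ⟨i, List.mem_range.2 (by omega), rfl⟩

theorem zHeight_lt {u v : ℕ} (h : (u, v) ∈ zEdges) : zHeight u < zHeight v := by
  have key : ∀ e ∈ zEdgeList, zHeight e.1 < zHeight e.2 := by decide
  exact key _ (mem_zEdgeList h)

theorem zCoheight_lt {u v : ℕ} (h : (u, v) ∈ zEdges) : zCoheight v < zCoheight u := by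
  have key : ∀ e ∈ zEdgeList, zCoheight e.2 < zCoheight e.1 := by decide
  exact key _ (mem_zEdgeList h)

theorem le_zHeight_of_isWalk {k : ℕ} {c : ℕ → ℕ} (hc : IsWalk zGraph k c) :
    ∀ i ≤ k, i ≤ zHeight (c i) := by
  intro i
  induction i with
  | zero => intro _; exact Nat.zero_le _
  | succ i ih =>
    intro hi
    have h1 := ih (by omega)
    have h2 := zHeight_lt (hc i (by omega))
    omega

theorem le_zCoheight_of_isWalk {k : ℕ} {c : ℕ → ℕ} (hc : IsWalk zGraph k c) :
    k ≤ zCoheight (c 0) := by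
  induction k generalizing c with
  | zero => exact Nat.zero_le _
  | succ k ih =>
    have h1 := ih (c := fun i => c (i + 1)) fun i hi => hc (i + 1) (by omega)
    have h2 := zCoheight_lt (hc 0 (by omega))
    simp only [zero_add] at h1 h2
    omega

/-- The midpoint of a zigzag of length `p ≥ 4` in `B_ZZZ` is some `x_{q,q}` with `q ≥ p`. -/
theorem zigzag_midpoint {y z p : ℕ} (hp : 4 ≤ p) (h : (y, z) ∈ zEdges)
    (hy : p ≤ zCoheight y) (hz : p ≤ zHeight z) : ∃ q, p ≤ q ∧ q ≤ 6 ∧ z = 100 * q + q := by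
  have key : ∀ e ∈ zEdgeList, 4 ≤ zCoheight e.1 → 4 ≤ zHeight e.2 →
      e.2 = 100 * zCoheight e.1 + zCoheight e.1 ∧ zCoheight e.1 ≤ 6 := by decide
  have := key _ (mem_zEdgeList h) (hp.trans hy) (hp.trans hz)
  exact ⟨zCoheight y, hy, this.2, this.1⟩

theorem zEdges_pred_first {u q : ℕ} (h : (u, 100 * q + 1) ∈ zEdges) : u = 0 := by
  have key : ∀ e ∈ zEdgeList, e.2 % 100 = 1 → e.1 = 0 := by decide
  exact key _ (mem_zEdgeList h) (by simp only; omega)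

theorem zEdges_pred {u v q r : ℕ} (hq4 : 4 ≤ q) (hq : q ≤ 6) (hr : 1 ≤ r) (hrq : r < q)
    (h : (u, v) ∈ zEdges) (hv : v = 100 * q + r + 1) (hu : r + 1 < q ∨ 1 ≤ zHeight u) :
    u = 100 * q + r := by
  have key : ∀ e ∈ zEdgeList, 2 ≤ e.2 % 100 → e.2 % 100 < 50 →
      (e.2 % 100 < e.2 / 100 ∨ 1 ≤ zHeight e.1) → e.1 + 1 = e.2 := by decide
  have := key _ (mem_zEdgeList h) (by simp only; omega) (by simp only; omega)
    (hu.imp (fun _ => by simp only; omega) id)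
  simp only at this
  omega

theorem zigzag_walk {p q : ℕ} {c : ℕ → ℕ} (hp : 4 ≤ p) (hpq : p ≤ q) (hq : q ≤ 6)
    (hc : IsWalk zGraph p c) (hcp : c p = 100 * q + q) :
    c 1 = 100 * q + (q - p) + 1 := by
  have key : ∀ j < p, c (p - j) = 100 * q + (q - j) := by
    intro j
    induction j with
    | zero => intro _; exact hcp
    | succ j ih =>
      intro hj
      have h1 := ih (by omega)
      have h2 := hc (p - (j + 1)) (by omega)
      have h3 := le_zHeight_of_isWalk hc (p - (j + 1)) (by omega)
      rw [show p - (j + 1) + 1 = p - j by omega] at h2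
      exact zEdges_pred (by omega) hq (by omega) (by omega) h2 (by omega) (Or.inr (by omega))
  have := key (p - 1) (by omega)
  rw [show p - (p - 1) = 1 by omega] at this
  omega

theorem zigzag_unique {p : ℕ} {c d : ℕ → ℕ} (hp : 4 ≤ p) (hp6 : p = 6 ∨ c 0 = 0)
    (hc : IsWalk zGraph p c) (hdc : (d 0, c p) ∈ zEdges) (hd : IsWalk zGraph p d) :
    c 0 = 0 ∧ c 1 = 100 * p + 1 := by
  obtain ⟨q, hpq, hq, hcp⟩ := zigzag_midpoint hp hdc (le_zCoheight_of_isWalk hd)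
    (le_zHeight_of_isWalk hc p le_rfl)
  have h1 := zigzag_walk hp hpq hq hc hcp
  have h0 : (c 0, c 1) ∈ zEdges := hc 0 (by omega)
  obtain rfl : p = q := by
    by_contra hne
    have := zEdges_pred (r := q - p) (by omega) hq (by omega) (by omega) h0 h1
      (Or.inl (by omega))
    omega
  rw [Nat.sub_self, add_zero] at h1
  rw [h1] at h0
  exact ⟨zEdges_pred_first h0, h1⟩

/-- Endomorphisms of `B_ZZZ` fix the successors of the node `a`. -/
theorem zGraph_endo_fixes {φ : ℕ → ℕ} (hφ : ∀ e ∈ zEdges, (φ e.1, φ e.2) ∈ zEdges)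
    {p : ℕ} (hp : p ∈ zChainPs) : φ (100 * p + 1) = 100 * p + 1 := by
  have key : ∀ p ∈ zChainPs, (p = 6 ∨ φ 0 = 0) → φ 0 = 0 ∧ φ (100 * p + 1) = 100 * p + 1 := by
    intro p hp h0
    have hp4 : 4 ≤ p := by rcases hp with rfl | rfl | rfl <;> omega
    have hp0 : p ≠ 0 := by omega
    have := zigzag_unique (c := fun i => if i = 0 then φ 0 else φ (100 * p + i))
      (d := fun i => φ (100 * p + 50 + i)) hp4 (by simpa using h0)
      (isWalk_zigzag_left (G := zGraph) hφ hp)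
      (by simpa [hp0] using hφ _ ⟨p, hp, Or.inr (Or.inr (Or.inl rfl))⟩)
      (fun i hi => hφ _ ⟨p, hp, Or.inr (Or.inr (Or.inr ⟨i, hi, rfl⟩))⟩)
    simpa using this
  exact (key p hp (Or.inr (key 6 (by simp [zChainPs]) (Or.inl rfl)).1)).2

/-- `G` is a finite graph in which every node has at most two successors, and `f` is a
homomorphism from `G` to `B`. -/
structure IsSparseOver (B G : Graph Unit) (f : ℕ → ℕ) : Prop where
  finite : (G ()).Finite
  outdegree : ∀ u a b c, (u, a) ∈ G () → (u, b) ∈ G () → (u, c) ∈ G () → a = b ∨ a = c ∨ b = c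
  hom : ∀ u v, (u, v) ∈ G () → (f u, f v) ∈ B ()

/-- `G` is sparse over `B` by a homomorphism mapping `s` to `m`, and the node `s` of `G` has at
most one successor. -/
def IsThread (B G : Graph Unit) (s m : ℕ) : Prop :=
  (∃ f, IsSparseOver B G f ∧ f s = m) ∧ s ∈ adom G ∧
    ∀ a b, (s, a) ∈ G () → (s, b) ∈ G () → a = b

/-- `G` with an additional edge. -/
def addEdge (G : Graph Unit) (e : ℕ × ℕ) : Graph Unit := fun _ => insert e (G ())

theorem exists_fresh {G : Graph Unit} (hG : (G ()).Finite) (s : ℕ) :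
    ∃ k, s < k ∧ ∀ u v, (u, v) ∈ G () → u < k ∧ v < k := by
  obtain ⟨a, ha⟩ := (hG.image Prod.fst).bddAbove
  obtain ⟨b, hb⟩ := (hG.image Prod.snd).bddAbove
  refine ⟨max s (max a b) + 1, by omega, fun u v h => ?_⟩
  have h1 : u ≤ a := ha ⟨_, h, rfl⟩
  have h2 : v ≤ b := hb ⟨_, h, rfl⟩
  omega

theorem addEdge_subset (G : Graph Unit) (e : ℕ × ℕ) : G () ⊆ addEdge G e () :=
  Set.subset_insert _ _

theorem mem_addEdge (G : Graph Unit) (e : ℕ × ℕ) : e ∈ addEdge G e () :=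
  Set.mem_insert _ _

theorem IsThread.addEdge_from {B G : Graph Unit} {s m n : ℕ} (h : IsThread B G s n)
    (hmn : (m, n) ∈ B ()) :
    ∃ k, IsThread B (addEdge G (k, s)) k m := by
  obtain ⟨⟨f, hf, rfl⟩, hs, hs1⟩ := h
  obtain ⟨k, hsk, hk⟩ := exists_fresh hf.finite s
  refine ⟨k, ⟨Function.update f k m, ⟨hf.finite.insert _, ?_, ?_⟩, by simp⟩,
    ⟨s, (), Or.inl (mem_addEdge _ _)⟩, ?_⟩
  · intro u a b c ha hb hc
    have := hf.outdegree u a b c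
    have := fun v => hk u v
    simp only [addEdge, Set.mem_insert_iff, Prod.mk.injEq] at ha hb hc
    grind
  · rintro u v (he | he)
    · obtain ⟨rfl, rfl⟩ := Prod.mk.inj he
      simpa [hsk.ne] using hmn
    · have := hk u v he
      simpa [this.1.ne, this.2.ne] using hf.hom u v he
  · intro a b ha hb
    have := fun v => hk k v
    simp only [addEdge, Set.mem_insert_iff, Prod.mk.injEq] at ha hb
    grind

theorem IsThread.addEdge_to {B G : Graph Unit} {s m n : ℕ} (h : IsThread B G s m)
    (hmn : (m, n) ∈ B ()) :
    ∃ k, IsThread B (addEdge G (s, k)) k n := by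
  obtain ⟨⟨f, hf, rfl⟩, hs, hs1⟩ := h
  obtain ⟨k, hsk, hk⟩ := exists_fresh hf.finite s
  refine ⟨k, ⟨Function.update f k n, ⟨hf.finite.insert _, ?_, ?_⟩, by simp⟩,
    ⟨s, (), Or.inr (mem_addEdge _ _)⟩, ?_⟩
  · intro u a b c ha hb hc
    have := hf.outdegree u a b c
    simp only [addEdge, Set.mem_insert_iff, Prod.mk.injEq] at ha hb hc
    grind
  · rintro u v (he | he)
    · obtain ⟨rfl, rfl⟩ := Prod.mk.inj he
      simpa [hsk.ne] using hmn
    · have := hk u v he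
      simpa [this.1.ne, this.2.ne] using hf.hom u v he
  · intro a b ha hb
    have := fun v => hk k v
    simp only [addEdge, Set.mem_insert_iff, Prod.mk.injEq] at ha hb
    grind

theorem IsSparseOver.exists_thread {B G : Graph Unit} {f : ℕ → ℕ} (hf : IsSparseOver B G f)
    (s : ℕ) {m : ℕ} (hm : m ∈ adom B) :
    ∃ (G' : Graph Unit) (t : ℕ), G () ⊆ G' () ∧ t ≠ s ∧ IsThread B G' t m := by
  obtain ⟨k, hsk, hk⟩ := exists_fresh hf.finite s
  obtain ⟨n, ⟨⟩, hmn | hmn⟩ := hm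
  · refine ⟨addEdge G (k, k + 1), k, addEdge_subset _ _, hsk.ne', ⟨Function.update
      (Function.update f k m) (k + 1) n, ⟨hf.finite.insert _, ?_, ?_⟩, by simp⟩,
      ⟨_, (), Or.inl (mem_addEdge _ _)⟩, ?_⟩
    · intro u a b c ha hb hc
      have := hf.outdegree u a b c
      have := fun v => hk u v
      simp only [addEdge, Set.mem_insert_iff, Prod.mk.injEq] at ha hb hc
      grind
    · rintro u v (he | he)
      · obtain ⟨rfl, rfl⟩ := Prod.mk.inj he
        simpa using hmn
      · have := hk u v he
        have h1 : u ≠ k ∧ u ≠ k + 1 ∧ v ≠ k ∧ v ≠ k + 1 := by omega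
        simpa [h1] using hf.hom u v he
    · intro a b ha hb
      have := fun v => hk k v
      simp only [addEdge, Set.mem_insert_iff, Prod.mk.injEq] at ha hb
      grind
  · refine ⟨addEdge G (k + 1, k), k, addEdge_subset _ _, hsk.ne', ⟨Function.update
      (Function.update f k m) (k + 1) n, ⟨hf.finite.insert _, ?_, ?_⟩, by simp⟩,
      ⟨_, (), Or.inr (mem_addEdge _ _)⟩, ?_⟩
    · intro u a b c ha hb hc
      have := hf.outdegree u a b c
      have := fun v => hk u v
      simp only [addEdge, Set.mem_insert_iff, Prod.mk.injEq] at ha hb hc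
      grind
    · rintro u v (he | he)
      · obtain ⟨rfl, rfl⟩ := Prod.mk.inj he
        simpa using hmn
      · have := hk u v he
        have h1 : u ≠ k ∧ u ≠ k + 1 ∧ v ≠ k ∧ v ≠ k + 1 := by omega
        simpa [h1] using hf.hom u v he
    · intro a b ha hb
      have := fun v => hk k v
      simp only [addEdge, Set.mem_insert_iff, Prod.mk.injEq] at ha hb
      grind

theorem adom_mono {G H : Graph Unit} (h : G () ⊆ H ()) : adom G ⊆ adom H := by
  rintro m ⟨n, ⟨⟩, hn⟩
  exact ⟨n, (), hn.imp (fun x => h x) (fun x => h x)⟩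

theorem eval_mono {e : Expr Unit} (he : e.InFrag {Feature.conv, Feature.di}) {G H : Graph Unit}
    (h : G () ⊆ H ()) : eval e G ⊆ eval e H := by
  induction e with
  | rel R => exact h
  | empty => exact subset_rfl
  | id => exact fun p hp => ⟨hp.1, adom_mono h hp.2⟩
  | comp e₁ e₂ ih₁ ih₂ =>
    exact fun p ⟨z, hz₁, hz₂⟩ => ⟨z, ih₁ he.1 hz₁, ih₂ he.2 hz₂⟩
  | union e₁ e₂ ih₁ ih₂ => exact Set.union_subset_union (ih₁ he.1) (ih₂ he.2)
  | di => exact fun p hp => ⟨adom_mono h hp.1, adom_mono h hp.2.1, hp.2.2⟩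
  | conv e ih => exact fun p hp => ih he.2 hp
  | _ => simp [Expr.InFrag] at he

theorem mem_adom_of_mem_eval {e : Expr Unit} (he : e.InFrag {Feature.conv, Feature.di})
    {G : Graph Unit} {m n : ℕ} (h : (m, n) ∈ eval e G) : m ∈ adom G ∧ n ∈ adom G := by
  induction e generalizing m n with
  | rel R => exact ⟨⟨n, R, Or.inl h⟩, ⟨m, R, Or.inr h⟩⟩
  | empty => exact h.elim
  | id =>
    obtain ⟨hmn, h⟩ := h
    obtain rfl : m = n := hmn
    exact ⟨h, h⟩
  | comp e₁ e₂ ih₁ ih₂ =>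
    obtain ⟨z, hz₁, hz₂⟩ := h
    exact ⟨(ih₁ he.1 hz₁).1, (ih₂ he.2 hz₂).2⟩
  | union e₁ e₂ ih₁ ih₂ => exact h.elim (ih₁ he.1) (ih₂ he.2)
  | di => exact ⟨h.1, h.2.1⟩
  | conv e ih => exact (ih he.2 h).symm
  | _ => simp [Expr.InFrag] at he

/-- Matches of an expression of `N(⁻¹, di)` in `B` lift to extensions of a thread over `B`,
in both directions. -/
theorem IsThread.exists_lift {B : Graph Unit} {e : Expr Unit}
    (he : e.InFrag {Feature.conv, Feature.di}) {m n : ℕ} (hmn : (m, n) ∈ eval e B) :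
    (∀ (G : Graph Unit) (s : ℕ), IsThread B G s n → ∃ (G' : Graph Unit) (t : ℕ),
      G () ⊆ G' () ∧ IsThread B G' t m ∧ (t, s) ∈ eval e G') ∧
    (∀ (G : Graph Unit) (s : ℕ), IsThread B G s m → ∃ (G' : Graph Unit) (t : ℕ),
      G () ⊆ G' () ∧ IsThread B G' t n ∧ (s, t) ∈ eval e G') := by
  induction e generalizing m n with
  | rel R =>
    refine ⟨fun G s hs => ?_, fun G s hs => ?_⟩
    · obtain ⟨k, hk⟩ := hs.addEdge_from hmn
      exact ⟨_, k, addEdge_subset _ _, hk, mem_addEdge _ _⟩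
    · obtain ⟨k, hk⟩ := hs.addEdge_to hmn
      exact ⟨_, k, addEdge_subset _ _, hk, mem_addEdge _ _⟩
  | empty => exact hmn.elim
  | id =>
    obtain rfl : m = n := hmn.1
    exact ⟨fun G s hs => ⟨G, s, subset_rfl, hs, rfl, hs.2.1⟩,
      fun G s hs => ⟨G, s, subset_rfl, hs, rfl, hs.2.1⟩⟩
  | comp e₁ e₂ ih₁ ih₂ =>
    obtain ⟨z, hz₁, hz₂⟩ := hmn
    refine ⟨fun G s hs => ?_, fun G s hs => ?_⟩
    · obtain ⟨G₁, t₁, hG₁, ht₁, h₁⟩ := (ih₂ he.2 hz₂).1 G s hs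
      obtain ⟨G₂, t₂, hG₂, ht₂, h₂⟩ := (ih₁ he.1 hz₁).1 G₁ t₁ ht₁
      exact ⟨G₂, t₂, hG₁.trans hG₂, ht₂, t₁, h₂, eval_mono he.2 hG₂ h₁⟩
    · obtain ⟨G₁, t₁, hG₁, ht₁, h₁⟩ := (ih₁ he.1 hz₁).2 G s hs
      obtain ⟨G₂, t₂, hG₂, ht₂, h₂⟩ := (ih₂ he.2 hz₂).2 G₁ t₁ ht₁
      exact ⟨G₂, t₂, hG₁.trans hG₂, ht₂, t₁, eval_mono he.1 hG₂ h₁, h₂⟩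
  | union e₁ e₂ ih₁ ih₂ =>
    rcases hmn with h | h
    · have := ih₁ he.1 h
      exact ⟨fun G s hs => let ⟨G', t, h₁, h₂, h₃⟩ := this.1 G s hs; ⟨G', t, h₁, h₂, Or.inl h₃⟩,
        fun G s hs => let ⟨G', t, h₁, h₂, h₃⟩ := this.2 G s hs; ⟨G', t, h₁, h₂, Or.inl h₃⟩⟩
    · have := ih₂ he.2 h
      exact ⟨fun G s hs => let ⟨G', t, h₁, h₂, h₃⟩ := this.1 G s hs; ⟨G', t, h₁, h₂, Or.inr h₃⟩,
        fun G s hs => let ⟨G', t, h₁, h₂, h₃⟩ := this.2 G s hs; ⟨G', t, h₁, h₂, Or.inr h₃⟩⟩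
  | di =>
    obtain ⟨hm, hn, -⟩ := hmn
    refine ⟨fun G s hs => ?_, fun G s hs => ?_⟩
    · obtain ⟨⟨f, hf, -⟩, hs, -⟩ := hs
      obtain ⟨G', t, hG, hts, ht⟩ := hf.exists_thread s hm
      exact ⟨G', t, hG, ht, ht.2.1, adom_mono hG hs, hts⟩
    · obtain ⟨⟨f, hf, -⟩, hs, -⟩ := hs
      obtain ⟨G', t, hG, hts, ht⟩ := hf.exists_thread s hn
      exact ⟨G', t, hG, ht, adom_mono hG hs, ht.2.1, hts.symm⟩
  | conv e ih => exact (ih he.2 hmn).symm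
  | _ => simp [Expr.InFrag] at he

/-- If an expression of `N(⁻¹, di)` is nonempty on `B`, it is nonempty on a graph of outdegree at
most two that maps homomorphically to `B`. -/
theorem exists_sparse_nonempty {B : Graph Unit} {e : Expr Unit}
    (he : e.InFrag {Feature.conv, Feature.di}) (h : (eval e B).Nonempty) :
    ∃ (G : Graph Unit) (f : ℕ → ℕ), IsSparseOver B G f ∧ (eval e G).Nonempty := by
  obtain ⟨⟨m, n⟩, hmn⟩ := h
  have h0 : IsSparseOver B (fun _ => ∅) id :=
    ⟨Set.finite_empty, fun _ _ _ _ h => h.elim, fun _ _ h => h.elim⟩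
  obtain ⟨G, s, -, -, hs⟩ := h0.exists_thread 0 (mem_adom_of_mem_eval he hmn).2
  obtain ⟨G', t, -, ⟨⟨f, hf, -⟩, -⟩, h⟩ := (IsThread.exists_lift he hmn).1 G s hs
  exact ⟨G', f, hf, _, h⟩

theorem not_QZZZ_of_isSparseOver {G : Graph Unit} {f : ℕ → ℕ} (hf : IsSparseOver zGraph G f) :
    ¬ QZZZ G := by
  rintro ⟨h, -, hh⟩
  have hfix : ∀ p ∈ zChainPs, f (h (100 * p + 1)) = 100 * p + 1 := fun p hp =>
    zGraph_endo_fixes (φ := f ∘ h) (fun e he => hf.hom _ _ (hh e he)) hp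
  have hedge : ∀ p ∈ zChainPs, (h 0, h (100 * p + 1)) ∈ G () := fun p hp =>
    hh (0, 100 * p + 1) ⟨p, hp, Or.inl rfl⟩
  have m4 : 4 ∈ zChainPs := by simp [zChainPs]
  have m5 : 5 ∈ zChainPs := by simp [zChainPs]
  have m6 : 6 ∈ zChainPs := by simp [zChainPs]
  have h4 := hfix 4 m4
  have h5 := hfix 5 m5
  have h6 := hfix 6 m6
  rcases hf.outdegree _ _ _ _ (hedge 4 m4) (hedge 5 m5) (hedge 6 m6) with h | h | h
  · rw [h] at h4; omega
  · rw [h] at h4; omega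
  · rw [h] at h5; omega

theorem zExpr_nonempty_iff_QZZZ (G : Graph Unit) : (eval zExpr G).Nonempty ↔ QZZZ G :=
  zExpr_nonempty_iff.trans QZZZ_iff_hasZigzag.symm

theorem QZZZ_not_expressible {e : Expr Unit} (he : e.InFrag {Feature.conv, Feature.di}) :
    ¬ ∀ G : Graph Unit, (eval e G).Nonempty ↔ QZZZ G := by
  intro h
  obtain ⟨G, f, hf, hG⟩ := exists_sparse_nonempty he
    ((h zGraph).2 (QZZZ_iff.2 ⟨id, fun e he => he⟩))
  exact not_QZZZ_of_isSparseOver hf ((h G).1 hG)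

/-- `N(π) ≰bool N(⁻¹, di)`: the boolean query `Q_ZZZ` is expressed
in `N(π)` by the concrete expression `zExpr`, but is not expressed by any
expression of `N(⁻¹, di)`. -/
theorem proj_not_leqBool_conv_di :
    zExpr.InFrag {Feature.proj} ∧
    (∀ G : Graph Unit, (eval zExpr G).Nonempty ↔ QZZZ G) ∧
    (∀ e : Expr Unit, e.InFrag {Feature.conv, Feature.di} →
      ¬ (∀ G : Graph Unit, (eval e G).Nonempty ↔ QZZZ G)) ∧
    ¬ leqBool Unit {Feature.proj} {Feature.conv, Feature.di} := by
  have hfrag : zExpr.InFrag {Feature.proj} := by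
    simp [zExpr, zExprBlock, rpow, Expr.InFrag]
  refine ⟨hfrag, zExpr_nonempty_iff_QZZZ, fun e he => QZZZ_not_expressible he, fun h => ?_⟩
  obtain ⟨e, he, heq⟩ := h zExpr hfrag
  exact QZZZ_not_expressible he fun G => (heq G).trans (zExpr_nonempty_iff_QZZZ G)

end NavGraph
end

section
/- Let k be a natural number, let e be an expression of N(∖, di) of degree at most k, and let (G1,a1,b1) and (G2,a2,b2) be marked graphs with (G1,a1,b1) ≃_k (G2,a2,b2). Then (a1,b1) ∈ e(G1) if and only if (a2,b2) ∈ e(G2). -/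
namespace NavGraph

/-- The atomic conditions of bisimilarity between marked graphs. -/
def bisimAtoms {Λ : Type} (G₁ : Graph Λ) (a₁ b₁ : ℕ) (G₂ : Graph Λ) (a₂ b₂ : ℕ) : Prop :=
  (a₁ = b₁ ↔ a₂ = b₂) ∧ ∀ R : Λ, ((a₁, b₁) ∈ G₁ R ↔ (a₂, b₂) ∈ G₂ R)

/-- Bisimilarity up to depth `k` of the marked graphs `(G₁,a₁,b₁)` and
`(G₂,a₂,b₂)`. -/
def bisim {Λ : Type} : ℕ → Graph Λ → ℕ → ℕ → Graph Λ → ℕ → ℕ → Prop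
  | 0, G₁, a₁, b₁, G₂, a₂, b₂ => bisimAtoms G₁ a₁ b₁ G₂ a₂ b₂
  | k + 1, G₁, a₁, b₁, G₂, a₂, b₂ =>
      bisimAtoms G₁ a₁ b₁ G₂ a₂ b₂ ∧
      (∀ c₁ ∈ adom G₁, ∃ c₂ ∈ adom G₂,
        bisim k G₁ a₁ c₁ G₂ a₂ c₂ ∧ bisim k G₁ c₁ b₁ G₂ c₂ b₂) ∧
      (∀ c₂ ∈ adom G₂, ∃ c₁ ∈ adom G₁,
        bisim k G₁ a₁ c₁ G₂ a₂ c₂ ∧ bisim k G₁ c₁ b₁ G₂ c₂ b₂)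

/-- The value of an expression is a binary relation on the active domain. -/
theorem mem_adom_of_mem_eval_s5 {Λ : Type} (G : Graph Λ) (e : Expr Λ) :
    ∀ a b : ℕ, (a, b) ∈ eval e G → a ∈ adom G ∧ b ∈ adom G := by
  induction e with
  | rel R => exact fun a b h => ⟨⟨b, R, Or.inl h⟩, ⟨a, R, Or.inr h⟩⟩
  | empty => exact fun a b h => h.elim
  | id =>
    rintro a b ⟨rfl : a = b, h⟩
    exact ⟨h, h⟩
  | comp e₁ e₂ ih₁ ih₂ =>
    rintro a b ⟨z, h₁, h₂⟩
    exact ⟨(ih₁ _ _ h₁).1, (ih₂ _ _ h₂).2⟩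
  | union e₁ e₂ ih₁ ih₂ => exact fun a b h => h.elim (ih₁ a b) (ih₂ a b)
  | di => exact fun a b h => ⟨h.1, h.2.1⟩
  | conv e ih => exact fun a b h => (ih b a h).symm
  | inter e₁ e₂ ih₁ _ => exact fun a b h => ih₁ a b h.1
  | diff e₁ e₂ ih₁ _ => exact fun a b h => ih₁ a b h.1
  | proj1 e _ | proj2 e _ | coproj1 e _ | coproj2 e _ =>
    rintro a b ⟨rfl : a = b, h, _⟩
    exact ⟨h, h⟩

/-- Bisimilar marked graphs satisfy the atomic conditions. -/
theorem bisim.atoms {Λ : Type} {k : ℕ} {G₁ G₂ : Graph Λ} {a₁ b₁ a₂ b₂ : ℕ}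
    (h : bisim k G₁ a₁ b₁ G₂ a₂ b₂) : bisimAtoms G₁ a₁ b₁ G₂ a₂ b₂ := by
  cases k with
  | zero => exact h
  | succ k => exact h.1

/-- Expressions of `N(∖, di)` of degree at most `k` are invariant
under bisimulation up to depth `k`. -/
theorem bisim_invariance (Λ : Type) [Fintype Λ] [Nonempty Λ]
    (k : ℕ) (e : Expr Λ) (he : e.InFrag {Feature.diff, Feature.di})
    (hdeg : degree e ≤ k) (G₁ G₂ : Graph Λ) (a₁ b₁ a₂ b₂ : ℕ)
    (ha₁ : a₁ ∈ adom G₁) (hb₁ : b₁ ∈ adom G₁)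
    (ha₂ : a₂ ∈ adom G₂) (hb₂ : b₂ ∈ adom G₂)
    (hbis : bisim k G₁ a₁ b₁ G₂ a₂ b₂) :
    (a₁, b₁) ∈ eval e G₁ ↔ (a₂, b₂) ∈ eval e G₂ := by
  induction e generalizing k a₁ b₁ a₂ b₂ with
  | rel R => exact hbis.atoms.2 R
  | empty => exact Iff.rfl
  | id => exact and_congr hbis.atoms.1 (iff_of_true ha₁ ha₂)
  | di =>
    exact and_congr (iff_of_true ha₁ ha₂)
      (and_congr (iff_of_true hb₁ hb₂) (not_congr hbis.atoms.1))
  | union e₁ e₂ ih₁ ih₂ =>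
    obtain ⟨h₁, h₂⟩ := max_le_iff.1 hdeg
    exact or_congr (ih₁ k he.1 h₁ a₁ b₁ a₂ b₂ ha₁ hb₁ ha₂ hb₂ hbis)
      (ih₂ k he.2 h₂ a₁ b₁ a₂ b₂ ha₁ hb₁ ha₂ hb₂ hbis)
  | diff e₁ e₂ ih₁ ih₂ =>
    obtain ⟨h₁, h₂⟩ := max_le_iff.1 hdeg
    exact and_congr (ih₁ k he.2.1 h₁ a₁ b₁ a₂ b₂ ha₁ hb₁ ha₂ hb₂ hbis)
      (not_congr (ih₂ k he.2.2 h₂ a₁ b₁ a₂ b₂ ha₁ hb₁ ha₂ hb₂ hbis))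
  | comp e₁ e₂ ih₁ ih₂ =>
    cases k with
    | zero => exact absurd hdeg (Nat.not_succ_le_zero _)
    | succ k =>
      obtain ⟨h₁, h₂⟩ := max_le_iff.1 (Nat.le_of_succ_le_succ hdeg)
      obtain ⟨-, forth, back⟩ := hbis
      constructor
      · rintro ⟨c₁, hl, hr⟩
        have hc₁ := (mem_adom_of_mem_eval_s5 G₁ e₁ _ _ hl).2
        obtain ⟨c₂, hc₂, hbl, hbr⟩ := forth c₁ hc₁
        exact ⟨c₂, (ih₁ k he.1 h₁ a₁ c₁ a₂ c₂ ha₁ hc₁ ha₂ hc₂ hbl).1 hl,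
          (ih₂ k he.2 h₂ c₁ b₁ c₂ b₂ hc₁ hb₁ hc₂ hb₂ hbr).1 hr⟩
      · rintro ⟨c₂, hl, hr⟩
        have hc₂ := (mem_adom_of_mem_eval_s5 G₂ e₁ _ _ hl).2
        obtain ⟨c₁, hc₁, hbl, hbr⟩ := back c₂ hc₂
        exact ⟨c₁, (ih₁ k he.1 h₁ a₁ c₁ a₂ c₂ ha₁ hc₁ ha₂ hc₂ hbl).2 hl,
          (ih₂ k he.2 h₂ c₁ b₁ c₂ b₂ hc₁ hb₁ hc₂ hb₂ hbr).2 hr⟩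
  | conv e _ | inter e₁ e₂ _ _ | proj1 e _ | proj2 e _ | coproj1 e _ | coproj2 e _ =>
    simp [Expr.InFrag] at he

end NavGraph
end

section
/- Let Q1: H1 ← B1 and Q2: H2 ← B2 be conjunctive queries with nonequalities over Λ, and assume B1 contains no nonequality of the form x ≠ x (so that the identity assignment is a matching of B1 in B1^rel). If Q1 is contained in Q2, then there exists a homomorphism from B2^rel to B1^rel. -/
namespace NavGraph

/-- A conjunctive query with nonequalities over `Λ` (variables are natural
numbers): a finite set of relation atoms `R(x,y)`, a finite set of
nonequalities `x ≠ y`, and a head tuple of variables of the body. -/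
structure CQ (Λ : Type) where
  atoms : Set (Λ × ℕ × ℕ)
  neqs : Set (ℕ × ℕ)
  head : List ℕ
  atoms_finite : atoms.Finite
  neqs_finite : neqs.Finite
  head_safe : ∀ v ∈ head,
    (∃ a ∈ atoms, a.2.1 = v ∨ a.2.2 = v) ∨ (∃ q ∈ neqs, q.1 = v ∨ q.2 = v)

/-- A matching of the body of `Q` in the graph `G`. -/
def CQ.Matching {Λ : Type} (Q : CQ Λ) (G : Graph Λ) (f : ℕ → ℕ) : Prop :=
  (∀ a ∈ Q.atoms, (f a.2.1, f a.2.2) ∈ G a.1) ∧ (∀ q ∈ Q.neqs, f q.1 ≠ f q.2)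

/-- The evaluation `Q(G)` of a conjunctive query with nonequalities. -/
def CQ.eval {Λ : Type} (Q : CQ Λ) (G : Graph Λ) : Set (List ℕ) :=
  {t | ∃ f : ℕ → ℕ, Q.Matching G f ∧ t = Q.head.map f}

/-- If `Q₁ ⊆ Q₂` (and `B₁` has no nonequality `x ≠ x`), then there
is a homomorphism from `B₂^rel` to `B₁^rel`. -/
theorem containment_gives_homomorphism (Λ : Type) [Fintype Λ] [Nonempty Λ]
    (Q₁ Q₂ : CQ Λ) (hirr : ∀ x : ℕ, (x, x) ∉ Q₁.neqs)
    (hcont : ∀ G : Graph Λ, Q₁.eval G ⊆ Q₂.eval G) :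
    ∃ h : ℕ → ℕ, ∀ a ∈ Q₂.atoms, (a.1, h a.2.1, h a.2.2) ∈ Q₁.atoms := by
  have hid : Q₁.Matching (fun R => {p | (R, p.1, p.2) ∈ Q₁.atoms}) _root_.id := by
    refine ⟨fun _ ha => ha, ?_⟩
    rintro ⟨x, y⟩ hq (rfl : x = y)
    exact hirr x hq
  obtain ⟨h, hmatch, -⟩ := hcont _ ⟨_root_.id, hid, rfl⟩
  exact ⟨h, hmatch.1⟩

end NavGraph
end

section
/- The graph B_ZZZ has no endomorphism other than the identity: every map h from the nodes of B_ZZZ to the nodes of B_ZZZ such that h(u) → h(v) is an edge whenever u → v is an edge is the identity map. -/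
namespace NavGraph

/-- The level of a node: every edge raises it by one, and `a` is the only node of level `0`. -/
def zLevel (v : ℕ) : ℕ :=
  if v % 100 < 50 then v % 100 else v / 100 + v % 100 - 51

lemma mem_zChainPs {p : ℕ} : p ∈ zChainPs ↔ p = 4 ∨ p = 5 ∨ p = 6 := by
  simp [zChainPs]

lemma mem_zEdges {u v : ℕ} : (u, v) ∈ zEdges ↔ ∃ p, (p = 4 ∨ p = 5 ∨ p = 6) ∧
    ((u = 0 ∧ v = 100 * p + 1) ∨
    (∃ i, 1 ≤ i ∧ i + 1 ≤ p ∧ u = 100 * p + i ∧ v = 100 * p + i + 1) ∨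
    (u = 100 * p + 50 ∧ v = 100 * p + p) ∨
    (∃ i, i + 1 ≤ p ∧ u = 100 * p + 50 + i ∧ v = 100 * p + 50 + i + 1)) := by
  simp [zEdges, mem_zChainPs]

lemma zLevel_of_edge {u v : ℕ} (e : (u, v) ∈ zEdges) : zLevel v = zLevel u + 1 := by
  unfold zLevel
  obtain ⟨p, hp, ⟨rfl, rfl⟩ | ⟨i, _, _, rfl, rfl⟩ | ⟨rfl, rfl⟩ | ⟨i, _, rfl, rfl⟩⟩ :=
    mem_zEdges.1 e <;> rcases hp with rfl | rfl | rfl <;> split_ifs <;> omega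

lemma zLevel_le {v : ℕ} (hv : v ∈ zNodes) : zLevel v ≤ 11 := by
  unfold zLevel
  obtain rfl | ⟨p, hp, ⟨i, _, _, rfl⟩ | ⟨i, _, rfl⟩⟩ := hv
  · simp
  all_goals rcases mem_zChainPs.1 hp with rfl | rfl | rfl <;> split_ifs <;> omega

lemma eq_zero_of_zLevel {v : ℕ} (hv : v ∈ zNodes) (h0 : zLevel v = 0) : v = 0 := by
  unfold zLevel at h0
  obtain rfl | ⟨p, hp, ⟨i, _, _, rfl⟩ | ⟨i, _, rfl⟩⟩ := hv
  · rfl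
  all_goals rcases mem_zChainPs.1 hp with rfl | rfl | rfl <;> split_ifs at h0 <;> omega

lemma edge_from_zero {v : ℕ} (e : (0, v) ∈ zEdges) : ∃ q ∈ zChainPs, v = 100 * q + 1 := by
  obtain ⟨p, hp, h | ⟨i, h⟩ | h | ⟨i, h⟩⟩ := mem_zEdges.1 e
  · exact ⟨p, mem_zChainPs.2 hp, h.2⟩
  all_goals omega

lemma edge_from_x {q i v : ℕ} (hi : 1 ≤ i) (hi' : i < 50) (e : (100 * q + i, v) ∈ zEdges) :
    v = 100 * q + i + 1 ∧ i + 1 ≤ q := by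
  obtain ⟨p, hp, h | ⟨j, h⟩ | h | ⟨j, h⟩⟩ := mem_zEdges.1 e <;> omega

lemma edge_from_y {q i v : ℕ} (hi : i < 50) (e : (100 * q + 50 + i, v) ∈ zEdges) :
    v = 100 * q + 50 + i + 1 ∨ (i = 0 ∧ v = 100 * q + q) := by
  obtain ⟨p, hp, h | ⟨j, h⟩ | h | ⟨j, h⟩⟩ := mem_zEdges.1 e <;> omega

lemma edge_into_x {q i u : ℕ} (hi : 2 ≤ i) (hi' : i < 50) (e : (u, 100 * q + i) ∈ zEdges) :
    u = 100 * q + (i - 1) ∨ (i = q ∧ u = 100 * q + 50) := by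
  obtain ⟨p, hp, h | ⟨j, h⟩ | h | ⟨j, h⟩⟩ := mem_zEdges.1 e <;> omega

lemma zLevel_walk {h : ℕ → ℕ} (hedge : ∀ e ∈ zEdges, (h e.1, h e.2) ∈ zEdges) (m n : ℕ)
    (hw : ∀ i < n, (m + i, m + i + 1) ∈ zEdges) : zLevel (h (m + n)) = zLevel (h m) + n := by
  induction n with
  | zero => rfl
  | succ n ih =>
    have := zLevel_of_edge (hedge _ (hw n (by omega)))
    have := ih fun i hi => hw i (by omega)
    grind

lemma edge_zero_x {p : ℕ} (hp : p ∈ zChainPs) : (0, 100 * p + 1) ∈ zEdges :=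
  ⟨p, hp, .inl rfl⟩

lemma edge_x {p i : ℕ} (hp : p ∈ zChainPs) (hi : 1 ≤ i) (hi' : i + 1 ≤ p) :
    (100 * p + i, 100 * p + i + 1) ∈ zEdges :=
  ⟨p, hp, .inr (.inl ⟨i, hi, hi', rfl⟩)⟩

lemma edge_y_x {p : ℕ} (hp : p ∈ zChainPs) : (100 * p + 50, 100 * p + p) ∈ zEdges :=
  ⟨p, hp, .inr (.inr (.inl rfl))⟩

lemma edge_y {p i : ℕ} (hp : p ∈ zChainPs) (hi : i + 1 ≤ p) :
    (100 * p + 50 + i, 100 * p + 50 + i + 1) ∈ zEdges :=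
  ⟨p, hp, .inr (.inr (.inr ⟨i, hi, rfl⟩))⟩

lemma map_zero_eq {h : ℕ → ℕ} (hmap : ∀ v ∈ zNodes, h v ∈ zNodes)
    (hedge : ∀ e ∈ zEdges, (h e.1, h e.2) ∈ zEdges) : h 0 = 0 := by
  have hp : 6 ∈ zChainPs := mem_zChainPs.2 (by omega)
  have h0 : 0 ∈ zNodes := .inl rfl
  have h656 : 656 ∈ zNodes := .inr ⟨6, hp, .inr ⟨6, le_rfl, rfl⟩⟩
  have ha := zLevel_of_edge (hedge _ (edge_zero_x hp))
  have hx := zLevel_walk hedge 601 5 fun i hi => by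
    have := edge_x hp (i := i + 1) (by omega) (by omega)
    convert this using 2 <;> omega
  have hyx := zLevel_of_edge (hedge _ (edge_y_x hp))
  have hy := zLevel_walk hedge 650 6 fun i hi => edge_y hp (by omega)
  have hle := zLevel_le (hmap 656 h656)
  norm_num at ha hx hyx hy
  exact eq_zero_of_zLevel (hmap 0 h0) (by omega)

lemma map_x {h : ℕ → ℕ} (hedge : ∀ e ∈ zEdges, (h e.1, h e.2) ∈ zEdges) (h0 : h 0 = 0)
    {p : ℕ} (hp : p ∈ zChainPs) :
    ∃ q ∈ zChainPs, ∀ i, 1 ≤ i → i ≤ p → h (100 * p + i) = 100 * q + i := by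
  have e := hedge _ (edge_zero_x hp)
  simp only [h0] at e
  obtain ⟨q, hq, h1⟩ := edge_from_zero e
  refine ⟨q, hq, fun i hi => ?_⟩
  induction i, hi using Nat.le_induction with
  | base => exact fun _ => h1
  | succ i hi ih =>
    intro hip
    have e := hedge _ (edge_x hp hi hip)
    simp only [ih (by omega)] at e
    have := mem_zChainPs.1 hp
    exact (edge_from_x hi (by omega) e).1

lemma map_y_zero {h : ℕ → ℕ} (hedge : ∀ e ∈ zEdges, (h e.1, h e.2) ∈ zEdges)
    {p q : ℕ} (hp : p ∈ zChainPs) (hq : q ∈ zChainPs) (hx : h (100 * p + p) = 100 * q + p) :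
    p = q ∧ h (100 * p + 50) = 100 * q + 50 := by
  have hp' := mem_zChainPs.1 hp
  have hq' := mem_zChainPs.1 hq
  have e := hedge _ (edge_y_x hp)
  simp only [hx] at e
  refine (edge_into_x (by omega) (by omega) e).resolve_left fun hy => ?_
  have walk : ∀ i ≤ p, h (100 * p + 50 + i) = 100 * q + (p - 1 + i) ∧ (1 ≤ i → p - 1 + i ≤ q) := by
    intro i
    induction i with
    | zero => exact fun _ => ⟨hy, by omega⟩
    | succ i ih =>
      intro hi
      have e := hedge _ (edge_y hp hi)
      simp only [(ih (by omega)).1] at e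
      have := edge_from_x (by omega) (by omega) e
      exact ⟨this.1, fun _ => this.2⟩
  have := (walk p le_rfl).2
  omega

lemma map_y {h : ℕ → ℕ} (hedge : ∀ e ∈ zEdges, (h e.1, h e.2) ∈ zEdges)
    {p : ℕ} (hp : p ∈ zChainPs) (hy : h (100 * p + 50) = 100 * p + 50) {i : ℕ} (hi : i ≤ p) :
    h (100 * p + 50 + i) = 100 * p + 50 + i := by
  have hp' := mem_zChainPs.1 hp
  induction i with
  | zero => exact hy
  | succ i ih =>
    have e := hedge _ (edge_y hp hi)
    simp only [ih (by omega)] at e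
    refine (edge_from_y (by omega) e).resolve_right ?_
    rintro ⟨rfl, hs⟩
    have e := hedge _ (edge_y hp (i := 1) (by omega))
    simp only [add_zero] at hs
    simp only [hs] at e
    have := edge_from_x (by omega) (by omega) e
    omega

/-- the pattern `B_ZZZ` has no endomorphism other than the
identity. -/
theorem bzzz_rigid (h : ℕ → ℕ) (hmap : ∀ v ∈ zNodes, h v ∈ zNodes)
    (hedge : ∀ e ∈ zEdges, (h e.1, h e.2) ∈ zEdges) :
    ∀ v ∈ zNodes, h v = v := by
  have h0 := map_zero_eq hmap hedge
  rintro v (rfl | ⟨p, hp, hv⟩)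
  · exact h0
  obtain ⟨q, hq, hx⟩ := map_x hedge h0 hp
  have hp' := mem_zChainPs.1 hp
  obtain ⟨rfl, hy⟩ := map_y_zero hedge hp hq (hx p (by omega) le_rfl)
  obtain ⟨i, hi, hip, rfl⟩ | ⟨i, hi, rfl⟩ := hv
  · exact hx i hi hip
  · exact map_y hedge hp hy hi

end NavGraph
end

section
/- Let F1 and F2 be sets of nonbasic features with di ∈ F̄1 and di ∉ F̄2. Then N(F1) is strongly separable from N(F2) at the level of boolean queries; in particular N(F1) ≰bool N(F2). Concretely, the graph G1 consisting of two R-self-loops on two distinct nodes and the graph G2 consisting of a single R-self-loop are distinguishable in N(F1) (by the nonemptiness of di) but indistinguishable in N(F2). -/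
namespace NavGraph

/-- The graph consisting of two `R`-self-loops on two distinct nodes. -/
def twoLoops (Λ : Type) [DecidableEq Λ] (R : Λ) : Graph Λ :=
  fun S => if S = R then {((0 : ℕ), (0 : ℕ)), ((1 : ℕ), (1 : ℕ))} else ∅

/-- The graph consisting of a single `R`-self-loop. -/
def oneLoop (Λ : Type) [DecidableEq Λ] (R : Λ) : Graph Λ :=
  fun S => if S = R then {((0 : ℕ), (0 : ℕ))} else ∅

/-- The graph consisting of an `R`-self-loop on each node of `A`. -/
def loops {Λ : Type} (R : Λ) (A : Set ℕ) : Graph Λ :=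
  fun S => {p | S = R ∧ p.1 = p.2 ∧ p.1 ∈ A}

theorem twoLoops_eq_loops (Λ : Type) [DecidableEq Λ] (R : Λ) :
    twoLoops Λ R = loops R {0, 1} := by
  funext S
  ext ⟨m, n⟩
  by_cases hS : S = R
  · simp only [twoLoops, loops, hS, if_true, Set.mem_insert_iff, Set.mem_singleton_iff,
      Prod.mk.injEq, Set.mem_ofPred_eq]
    grind
  · simp [twoLoops, loops, hS]

theorem oneLoop_eq_loops (Λ : Type) [DecidableEq Λ] (R : Λ) :
    oneLoop Λ R = loops R {0} := by
  funext S
  ext ⟨m, n⟩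
  by_cases hS : S = R
  · simp only [oneLoop, loops, hS, if_true, Set.mem_singleton_iff,
      Prod.mk.injEq, Set.mem_ofPred_eq]
    grind
  · simp [oneLoop, loops, hS]

theorem mem_adom_loops {Λ : Type} (R : Λ) (A : Set ℕ) (m : ℕ) :
    m ∈ adom (loops R A) ↔ m ∈ A := by
  constructor
  · rintro ⟨n, S, ⟨-, -, h⟩ | ⟨-, h, h'⟩⟩
    · exact h
    · exact (show n = m from h) ▸ h'
  · exact fun h => ⟨m, R, Or.inl ⟨rfl, rfl, h⟩⟩

/-- On graphs of self-loops, an expression without diversity is either always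
empty or always the identity. -/
theorem exists_mem_eval_loops_iff {Λ : Type} (R : Λ) {F : Set Feature}
    (hF : Feature.di ∉ F) (e : Expr Λ) (he : e.InFrag F) :
    ∃ P : Prop, ∀ (A : Set ℕ) (m n : ℕ),
      (m, n) ∈ eval e (loops R A) ↔ m = n ∧ m ∈ A ∧ P := by
  induction e with
  | rel S => exact ⟨S = R, fun A m n => by simp only [eval, loops, Set.mem_ofPred_eq]; tauto⟩
  | empty => exact ⟨False, fun A m n => by simp [eval]⟩
  | id => exact ⟨True, fun A m n => by simp [eval, mem_adom_loops]⟩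
  | di => exact absurd he hF
  | comp e₁ e₂ ih₁ ih₂ =>
    obtain ⟨P, hP⟩ := ih₁ he.1
    obtain ⟨Q, hQ⟩ := ih₂ he.2
    exact ⟨P ∧ Q, fun A m n => by simp only [eval, Set.mem_ofPred_eq, hP, hQ]; grind⟩
  | union e₁ e₂ ih₁ ih₂ =>
    obtain ⟨P, hP⟩ := ih₁ he.1
    obtain ⟨Q, hQ⟩ := ih₂ he.2
    exact ⟨P ∨ Q, fun A m n => by simp only [eval, Set.mem_union, hP, hQ]; tauto⟩
  | inter e₁ e₂ ih₁ ih₂ =>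
    obtain ⟨P, hP⟩ := ih₁ he.2.1
    obtain ⟨Q, hQ⟩ := ih₂ he.2.2
    exact ⟨P ∧ Q, fun A m n => by simp only [eval, Set.mem_inter_iff, hP, hQ]; tauto⟩
  | diff e₁ e₂ ih₁ ih₂ =>
    obtain ⟨P, hP⟩ := ih₁ he.2.1
    obtain ⟨Q, hQ⟩ := ih₂ he.2.2
    exact ⟨P ∧ ¬ Q, fun A m n => by simp only [eval, Set.mem_sdiff, hP, hQ]; tauto⟩
  | conv e ih =>
    obtain ⟨P, hP⟩ := ih he.2
    exact ⟨P, fun A m n => by simp only [eval, Set.mem_ofPred_eq, hP]; grind⟩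
  | proj1 e ih | proj2 e ih =>
    obtain ⟨P, hP⟩ := ih he.2
    exact ⟨P, fun A m n => by simp only [eval, Set.mem_ofPred_eq, mem_adom_loops, hP]; grind⟩
  | coproj1 e ih | coproj2 e ih =>
    obtain ⟨P, hP⟩ := ih he.2
    exact ⟨¬ P, fun A m n => by simp only [eval, Set.mem_ofPred_eq, mem_adom_loops, hP]; grind⟩

theorem eval_loops_nonempty_iff {Λ : Type} (R : Λ) {F : Set Feature}
    (hF : Feature.di ∉ F) (e : Expr Λ) (he : e.InFrag F) {A B : Set ℕ}
    (hA : A.Nonempty) (hB : B.Nonempty) :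
    (eval e (loops R A)).Nonempty ↔ (eval e (loops R B)).Nonempty := by
  obtain ⟨P, hP⟩ := exists_mem_eval_loops_iff R hF e he
  obtain ⟨a, ha⟩ := hA
  obtain ⟨b, hb⟩ := hB
  constructor
  · rintro ⟨⟨m, n⟩, h⟩
    exact ⟨(b, b), (hP B b b).2 ⟨rfl, hb, ((hP A m n).1 h).2.2⟩⟩
  · rintro ⟨⟨m, n⟩, h⟩
    exact ⟨(a, a), (hP A a a).2 ⟨rfl, ha, ((hP B m n).1 h).2.2⟩⟩

theorem finite_twoLoops (Λ : Type) [DecidableEq Λ] (R : Λ) : (twoLoops Λ R).Finite := by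
  intro S
  unfold twoLoops
  split_ifs <;> simp

theorem finite_oneLoop (Λ : Type) [DecidableEq Λ] (R : Λ) : (oneLoop Λ R).Finite := by
  intro S
  unfold oneLoop
  split_ifs <;> simp

theorem di_mem_of_mem_closure {F : Set Feature} (h : Feature.di ∈ closure F) :
    Feature.di ∈ F := by
  cases h with
  | base h => exact h

theorem StrongSepBool.not_leqBool {Λ : Type} {F₁ F₂ : Set Feature}
    (h : StrongSepBool Λ F₁ F₂) : ¬ leqBool Λ F₁ F₂ := by
  obtain ⟨e₁, G₁, G₂, he₁, -, -, h₁, h₂, hind⟩ := h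
  intro hle
  obtain ⟨e₂, he₂, heq⟩ := hle e₁ he₁
  exact h₂ ((heq G₂).1 ((hind e₂ he₂).1 ((heq G₁).2 h₁)))

/-- if `di ∈ F̄₁` and `di ∉ F̄₂` then `N(F₁)` is strongly separable
from `N(F₂)` at the level of boolean queries, witnessed by the two-self-loops
graph and the single-self-loop graph and the expression `di`. -/
theorem di_separation (Λ : Type) [Fintype Λ] [Nonempty Λ] [DecidableEq Λ]
    (R : Λ) (F₁ F₂ : Set Feature)
    (h₁ : Feature.di ∈ closure F₁) (h₂ : Feature.di ∉ closure F₂) :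
    (Expr.di : Expr Λ).InFrag F₁ ∧
    (eval (Expr.di : Expr Λ) (twoLoops Λ R)).Nonempty ∧
    eval (Expr.di : Expr Λ) (oneLoop Λ R) = ∅ ∧
    (∀ e₂ : Expr Λ, e₂.InFrag F₂ →
      ((eval e₂ (twoLoops Λ R)).Nonempty ↔ (eval e₂ (oneLoop Λ R)).Nonempty)) ∧
    StrongSepBool Λ F₁ F₂ ∧ ¬ leqBool Λ F₁ F₂ := by
  have hdi : (Expr.di : Expr Λ).InFrag F₁ := di_mem_of_mem_closure h₁
  have htwo : (eval (Expr.di : Expr Λ) (twoLoops Λ R)).Nonempty := by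
    rw [twoLoops_eq_loops]
    exact ⟨(0, 1), by simp [eval, mem_adom_loops]⟩
  have hone : eval (Expr.di : Expr Λ) (oneLoop Λ R) = ∅ := by
    rw [oneLoop_eq_loops]
    ext ⟨m, n⟩
    simp only [eval, mem_adom_loops, Set.mem_ofPred_eq, Set.mem_singleton_iff,
      Set.mem_empty_iff_false, iff_false]
    omega
  have hind (e₂ : Expr Λ) (he₂ : e₂.InFrag F₂) :
      (eval e₂ (twoLoops Λ R)).Nonempty ↔ (eval e₂ (oneLoop Λ R)).Nonempty := by
    rw [twoLoops_eq_loops, oneLoop_eq_loops]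
    exact eval_loops_nonempty_iff R (fun h => h₂ (.base h)) e₂ he₂ ⟨0, by simp⟩ ⟨0, by simp⟩
  have hsep : StrongSepBool Λ F₁ F₂ :=
    ⟨.di, twoLoops Λ R, oneLoop Λ R, hdi, finite_twoLoops Λ R, finite_oneLoop Λ R, htwo,
      by simp [hone], hind⟩
  exact ⟨hdi, htwo, hone, hind, hsep, hsep.not_leqBool⟩

end NavGraph
end

section
/- Let F1 and F2 be sets of nonbasic features with π̄ ∈ F̄1, π̄ ∉ F̄2, and ∖ ∉ F̄2. Then N(F1) is strongly separable from N(F2) at the level of boolean queries; in particular N(F1) ≰bool N(F2). Concretely, the non-monotone boolean query expressed by the nonemptiness of π̄2(R) is expressible in N(F1) but not in N(F2), since every expression of N(F2) defines a monotone query. -/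
namespace NavGraph

/-- What membership of each feature in the closure `F̄` says about `F` itself; it is vacuous for
intersection. -/
def ClosureSource (F : Set Feature) : Feature → Prop
  | .di => .di ∈ F
  | .conv => .conv ∈ F
  | .inter => True
  | .diff => .diff ∈ F
  | .proj => .coproj ∈ F ∨ .proj ∈ F ∨ .di ∈ F ∨ .conv ∈ F
  | .coproj => .coproj ∈ F ∨ .diff ∈ F ∧ (.proj ∈ F ∨ .di ∈ F ∨ .conv ∈ F)

theorem InClosure.closureSource {F : Set Feature} {x : Feature} (h : InClosure F x) :
    ClosureSource F x := by
  induction h with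
  | @base x hx => cases x <;> simp [ClosureSource, hx]
  | _ => simp only [ClosureSource] at * <;> tauto

/-- The second coprojection of a label is definable as soon as `π̄` is in the closure. -/
theorem exists_inFrag_eval_eq_coproj2 {Λ : Type} (R : Λ) {F : Set Feature}
    (h : Feature.coproj ∈ closure F) :
    ∃ e : Expr Λ, e.InFrag F ∧ ∀ G : Graph Λ, eval e G = eval (.coproj2 (.rel R)) G := by
  rcases InClosure.closureSource h with h | ⟨hd, h | h | h⟩
  · exact ⟨.coproj2 (.rel R), ⟨h, trivial⟩, fun _ => rfl⟩
  · refine ⟨.diff .id (.proj2 (.rel R)), ⟨hd, trivial, h, trivial⟩, fun G => ?_⟩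
    ext ⟨a, b⟩
    simp only [eval, Set.mem_sdiff, Set.mem_ofPred_eq]
    tauto
  · refine ⟨.diff .id (.comp (.union .di .id) (.rel R)),
      ⟨hd, trivial, ⟨h, trivial⟩, trivial⟩, fun G => ?_⟩
    ext ⟨a, b⟩
    simp only [eval, Set.mem_sdiff, Set.mem_ofPred_eq, Set.mem_union]
    constructor
    · rintro ⟨⟨rfl, ha⟩, hn⟩
      refine ⟨rfl, ha, fun ⟨n, hR⟩ => hn ⟨n, ?_, hR⟩⟩
      by_cases han : a = n
      · exact Or.inr ⟨han, ha⟩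
      · exact Or.inl ⟨ha, ⟨a, R, Or.inl hR⟩, han⟩
    · rintro ⟨rfl, ha, hn⟩
      exact ⟨⟨rfl, ha⟩, fun ⟨n, _, hR⟩ => hn ⟨n, hR⟩⟩
  · refine ⟨.diff .id (.comp (.conv (.rel R)) (.rel R)),
      ⟨hd, trivial, ⟨h, trivial⟩, trivial⟩, fun G => ?_⟩
    ext ⟨a, b⟩
    simp only [eval, Set.mem_sdiff, Set.mem_ofPred_eq]
    constructor
    · rintro ⟨⟨rfl, ha⟩, hn⟩
      exact ⟨rfl, ha, fun ⟨n, hR⟩ => hn ⟨n, hR, hR⟩⟩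
    · rintro ⟨rfl, ha, hn⟩
      exact ⟨⟨rfl, ha⟩, fun ⟨n, _, hR⟩ => hn ⟨n, hR⟩⟩

theorem adom_mono_s11 {Λ : Type} {G G' : Graph Λ} (h : ∀ S : Λ, G S ⊆ G' S) : adom G ⊆ adom G' := by
  rintro m ⟨n, S, hm⟩
  exact ⟨n, S, hm.imp (@h S _) (@h S _)⟩

/-- Expressions without difference and coprojection are monotone. -/
theorem eval_mono_s11 {Λ : Type} {F : Set Feature} (hc : Feature.coproj ∉ F) (hd : Feature.diff ∉ F)
    {G G' : Graph Λ} (h : ∀ S : Λ, G S ⊆ G' S) (e : Expr Λ) (he : e.InFrag F) :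
    eval e G ⊆ eval e G' := by
  have hadom := adom_mono_s11 h
  induction e with
  | rel S => exact h S
  | empty => exact subset_rfl
  | id => exact fun p hp => ⟨hp.1, hadom hp.2⟩
  | di => exact fun p hp => ⟨hadom hp.1, hadom hp.2.1, hp.2.2⟩
  | comp e₁ e₂ ih₁ ih₂ => exact fun p ⟨z, h₁, h₂⟩ => ⟨z, ih₁ he.1 h₁, ih₂ he.2 h₂⟩
  | union e₁ e₂ ih₁ ih₂ => exact Set.union_subset_union (ih₁ he.1) (ih₂ he.2)
  | conv e ih => exact fun p hp => ih he.2 hp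
  | inter e₁ e₂ ih₁ ih₂ => exact Set.inter_subset_inter (ih₁ he.2.1) (ih₂ he.2.2)
  | diff => exact absurd he.1 hd
  | proj1 e ih | proj2 e ih =>
    exact fun p ⟨h₁, h₂, n, hn⟩ => ⟨h₁, hadom h₂, n, ih he.2 hn⟩
  | coproj1 | coproj2 => exact absurd he.1 hc

/-- The graph whose relations are all complete, loops included, on the nodes `0`, `1` and `2`. -/
def completeThree (Λ : Type) : Graph Λ := fun _ => {p | p.1 < 3 ∧ p.2 < 3}

/-- `completeThree` with an additional edge from `3` to `0` for every label. -/
def completeThreeWithSource (Λ : Type) : Graph Λ :=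
  fun S => insert (3, 0) (completeThree Λ S)

theorem mem_adom_completeThree {Λ : Type} [Nonempty Λ] {a : ℕ} :
    a ∈ adom (completeThree Λ) ↔ a < 3 := by
  simp only [adom, completeThree, Set.mem_ofPred_eq, exists_const]
  exact ⟨fun ⟨_, h⟩ => h.elim And.left And.right, fun h => ⟨0, Or.inl ⟨h, by norm_num⟩⟩⟩

theorem completeThree_finite (Λ : Type) : (completeThree Λ).Finite := fun _ =>
  (Set.finite_Iio 3).prod (Set.finite_Iio 3)

theorem completeThreeWithSource_finite (Λ : Type) : (completeThreeWithSource Λ).Finite :=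
  fun S => (completeThree_finite Λ S).insert _

/-- For three variables, `completeThree` is universal: a pair of its nodes satisfies every monotone
expression satisfied by a pair of the same equality type in some graph. -/
theorem mem_eval_completeThree {Λ : Type} [Nonempty Λ] {F : Set Feature}
    (hc : Feature.coproj ∉ F) (hd : Feature.diff ∉ F) {G : Graph Λ} (e : Expr Λ)
    (he : e.InFrag F) {m n a b : ℕ} (hmn : (m, n) ∈ eval e G) (ha : a < 3) (hb : b < 3)
    (hab : a = b ↔ m = n) : (a, b) ∈ eval e (completeThree Λ) := by
  have exists_eq_iff : ∀ {x c : ℕ} (y : ℕ), c < 3 → ∃ d < 3, (c = d ↔ x = y) := by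
    intro x c y hc
    by_cases hxy : x = y
    · exact ⟨c, hc, by simp [hxy]⟩
    · rcases eq_or_ne c 0 with rfl | h
      · exact ⟨1, by norm_num, by simp [hxy]⟩
      · exact ⟨0, by norm_num, by simp [hxy, h]⟩
  induction e generalizing m n a b with
  | rel S => exact ⟨ha, hb⟩
  | empty => exact hmn.elim
  | id => exact ⟨hab.2 hmn.1, mem_adom_completeThree.2 ha⟩
  | di =>
    exact ⟨mem_adom_completeThree.2 ha, mem_adom_completeThree.2 hb,
      fun h => hmn.2.2 (hab.1 h)⟩
  | comp e₁ e₂ ih₁ ih₂ =>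
    obtain ⟨z, h₁, h₂⟩ := hmn
    obtain ⟨c, hc3, hac, hcb⟩ : ∃ c < 3, (a = c ↔ m = z) ∧ (c = b ↔ z = n) := by
      by_cases hmz : m = z
      · exact ⟨a, ha, by simp [hmz], by rw [hab, hmz]⟩
      · by_cases hzn : z = n
        · exact ⟨b, hb, by rw [hab, hzn], by simp [hzn]⟩
        · have : ∃ c < 3, c ≠ a ∧ c ≠ b := by
            interval_cases a <;> interval_cases b <;> decide
          obtain ⟨c, hc3, hca, hcb⟩ := this
          exact ⟨c, hc3, by simp [hmz, hca.symm], by simp [hzn, hcb]⟩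
    exact ⟨c, ih₁ he.1 h₁ ha hc3 hac, ih₂ he.2 h₂ hc3 hb hcb⟩
  | union e₁ e₂ ih₁ ih₂ =>
    exact hmn.imp (fun h => ih₁ he.1 h ha hb hab) (fun h => ih₂ he.2 h ha hb hab)
  | conv e ih => exact ih he.2 hmn hb ha (by rw [eq_comm, hab, eq_comm])
  | inter e₁ e₂ ih₁ ih₂ => exact ⟨ih₁ he.2.1 hmn.1 ha hb hab, ih₂ he.2.2 hmn.2 ha hb hab⟩
  | diff => exact absurd he.1 hd
  | proj1 e ih =>
    obtain ⟨h₁, -, k, hk⟩ := hmn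
    obtain ⟨d, hd3, had⟩ := exists_eq_iff (x := m) k ha
    exact ⟨hab.2 h₁, mem_adom_completeThree.2 ha, d, ih he.2 hk ha hd3 had⟩
  | proj2 e ih =>
    obtain ⟨h₁, -, k, hk⟩ := hmn
    obtain ⟨d, hd3, had⟩ := exists_eq_iff (x := m) k ha
    exact ⟨hab.2 h₁, mem_adom_completeThree.2 ha, d,
      ih he.2 hk hd3 ha (by rw [eq_comm, had, eq_comm])⟩
  | coproj1 | coproj2 => exact absurd he.1 hc

/-- Monotone expressions do not distinguish the two graphs. -/
theorem eval_completeThreeWithSource_nonempty_iff {Λ : Type} [Nonempty Λ] {F : Set Feature}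
    (hc : Feature.coproj ∉ F) (hd : Feature.diff ∉ F) (e : Expr Λ) (he : e.InFrag F) :
    (eval e (completeThreeWithSource Λ)).Nonempty ↔ (eval e (completeThree Λ)).Nonempty := by
  constructor
  · rintro ⟨⟨m, n⟩, hmn⟩
    by_cases h : m = n
    · exact ⟨(0, 0), mem_eval_completeThree hc hd e he hmn (by norm_num) (by norm_num)
        (by simp [h])⟩
    · exact ⟨(0, 1), mem_eval_completeThree hc hd e he hmn (by norm_num) (by norm_num)
        (by simp [h])⟩
  · exact Set.Nonempty.mono (eval_mono_s11 hc hd (fun _ => Set.subset_insert _ _) e he)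

theorem eval_coproj2_completeThreeWithSource_nonempty {Λ : Type} (R : Λ) :
    (eval (.coproj2 (.rel R)) (completeThreeWithSource Λ)).Nonempty := by
  refine ⟨(3, 3), rfl, ⟨0, R, Or.inl (Set.mem_insert _ _)⟩, ?_⟩
  simp [eval, completeThreeWithSource, completeThree]

theorem not_eval_coproj2_completeThree_nonempty {Λ : Type} (R : Λ) :
    ¬ (eval (.coproj2 (.rel R)) (completeThree Λ)).Nonempty := by
  have : Nonempty Λ := ⟨R⟩
  rintro ⟨p, -, hp, hn⟩
  exact hn ⟨0, by norm_num, mem_adom_completeThree.1 hp⟩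

/-- if `π̄ ∈ F̄₁`, `π̄ ∉ F̄₂` and `∖ ∉ F̄₂`, then `N(F₁)` is strongly
separable from `N(F₂)` at the level of boolean queries; the witnessing query is
the non-monotone boolean query expressed by the nonemptiness of `π̄₂(R)`, and
every expression of `N(F₂)` defines a monotone query. -/
theorem coproj_separation (Λ : Type) [Fintype Λ] [Nonempty Λ] (R : Λ)
    (F₁ F₂ : Set Feature) (h₁ : Feature.coproj ∈ closure F₁)
    (h₂ : Feature.coproj ∉ closure F₂) (h₃ : Feature.diff ∉ closure F₂) :
    (∃ e₁ : Expr Λ, e₁.InFrag F₁ ∧ ∀ G : Graph Λ,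
      ((eval e₁ G).Nonempty ↔ (eval (Expr.coproj2 (Expr.rel R)) G).Nonempty)) ∧
    (¬ ∃ e₂ : Expr Λ, e₂.InFrag F₂ ∧ ∀ G : Graph Λ,
      ((eval e₂ G).Nonempty ↔ (eval (Expr.coproj2 (Expr.rel R)) G).Nonempty)) ∧
    (∀ e₂ : Expr Λ, e₂.InFrag F₂ → ∀ G G' : Graph Λ,
      (∀ S : Λ, G S ⊆ G' S) → eval e₂ G ⊆ eval e₂ G') ∧
    StrongSepBool Λ F₁ F₂ ∧ ¬ leqBool Λ F₁ F₂ := by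
  have hc : Feature.coproj ∉ F₂ := fun h => h₂ (.base h)
  have hd : Feature.diff ∉ F₂ := fun h => h₃ (.base h)
  obtain ⟨e, he, heq⟩ := exists_inFrag_eval_eq_coproj2 R h₁
  have hiff : ∀ G : Graph Λ,
      (eval e G).Nonempty ↔ (eval (Expr.coproj2 (Expr.rel R)) G).Nonempty :=
    fun G => by rw [heq]
  have hnot : ¬ ∃ e₂ : Expr Λ, e₂.InFrag F₂ ∧ ∀ G : Graph Λ,
      ((eval e₂ G).Nonempty ↔ (eval (Expr.coproj2 (Expr.rel R)) G).Nonempty) := by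
    rintro ⟨e₂, he₂, h⟩
    exact not_eval_coproj2_completeThree_nonempty R <| (h _).1 <|
      (eval_completeThreeWithSource_nonempty_iff hc hd e₂ he₂).1 <|
        (h _).2 (eval_coproj2_completeThreeWithSource_nonempty R)
  refine ⟨⟨e, he, hiff⟩, hnot, fun e₂ he₂ G G' h => eval_mono_s11 hc hd h e₂ he₂,
    ⟨e, completeThreeWithSource Λ, completeThree Λ, he, completeThreeWithSource_finite Λ,
      completeThree_finite Λ, (hiff _).2 (eval_coproj2_completeThreeWithSource_nonempty R),
      fun h => not_eval_coproj2_completeThree_nonempty R ((hiff _).1 h),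
      eval_completeThreeWithSource_nonempty_iff hc hd⟩, fun hle => hnot ?_⟩
  obtain ⟨e₂, he₂, h⟩ := hle e he
  exact ⟨e₂, he₂, fun G => (h G).trans (hiff G)⟩

end NavGraph
end

section
/- Let F1 and F2 be sets of nonbasic features with ⁻¹ ∈ F̄1 and ⁻¹ ∉ F̄2. Then N(F1) is strongly separable from N(F2) at the level of path queries: there exist a path query q expressible in N(F1) and a finite graph G such that q(G) ≠ e(G) for every expression e of N(F2). In particular N(F1) ≰path N(F2). -/
namespace NavGraph

lemma conv_mem_of_conv_mem_closure {F : Set Feature} (h : Feature.conv ∈ closure F) :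
    Feature.conv ∈ F := by
  cases h with
  | base h => exact h

/-- A three-colouring of `ℤ/12ℤ`: colour `0` is the singleton `{0}`. The set of all unions of the
colour classes is closed under addition of sets, but not under negation. -/
def circColor (d : ZMod 12) : Fin 3 :=
  if d = 0 then 0 else if d = 1 ∨ d = 2 ∨ d = 3 ∨ d = 5 ∨ d = 8 then 1 else 2

lemma eq_zero_of_circColor_eq : ∀ d : ZMod 12, circColor d = circColor 0 → d = 0 := by
  decide +kernel

lemma exists_circColor_split : ∀ a d d' : ZMod 12, circColor d = circColor d' →
    ∃ a', circColor a' = circColor a ∧ circColor (d' - a') = circColor (d - a) := by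
  decide +kernel

/-- A binary relation on `{0, …, 11}` that is a union of colour classes of differences. -/
structure IsCircular (S : Set (ℕ × ℕ)) : Prop where
  fst_lt : ∀ {x y : ℕ}, (x, y) ∈ S → x < 12
  snd_lt : ∀ {x y : ℕ}, (x, y) ∈ S → y < 12
  mem_of_color_eq : ∀ {x y x' y' : ℕ}, (x, y) ∈ S → x' < 12 → y' < 12 →
    circColor ((y : ZMod 12) - x) = circColor ((y' : ZMod 12) - x') → (x', y') ∈ S

lemma eq_of_circColor_eq {x y x' : ℕ} (hx : x < 12) (hy : y < 12)
    (h : circColor ((x' : ZMod 12) - x') = circColor ((y : ZMod 12) - x)) : x = y := by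
  rw [sub_self] at h
  have h' := (sub_eq_zero.1 (eq_zero_of_circColor_eq _ h.symm)).symm
  rw [ZMod.natCast_eq_natCast_iff'] at h'
  rwa [Nat.mod_eq_of_lt hx, Nat.mod_eq_of_lt hy] at h'

namespace IsCircular

variable {S T : Set (ℕ × ℕ)}

lemma diag (P : ℕ → Prop) (h : ∀ x x' : ℕ, x < 12 → x' < 12 → P x → P x') :
    IsCircular {p | p.1 = p.2 ∧ p.1 < 12 ∧ P p.1} where
  fst_lt := fun h => h.2.1
  snd_lt := by
    rintro x y ⟨rfl : x = y, hx, -⟩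
    exact hx
  mem_of_color_eq := by
    rintro x y x' y' ⟨rfl : x = y, hx, hP⟩ hx' hy' hc
    exact ⟨eq_of_circColor_eq hx' hy' hc, hx', h _ _ hx hx' hP⟩

lemma exists_fst (hS : IsCircular S) (x x' : ℕ) (hx' : x' < 12) :
    (∃ n, (x, n) ∈ S) → ∃ n, (x', n) ∈ S := by
  rintro ⟨n, hn⟩
  exact ⟨((x' : ZMod 12) + (n - x)).val,
    hS.mem_of_color_eq hn hx' (ZMod.val_lt _) (by simp)⟩

lemma exists_snd (hS : IsCircular S) (x x' : ℕ) (hx' : x' < 12) :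
    (∃ n, (n, x) ∈ S) → ∃ n, (n, x') ∈ S := by
  rintro ⟨n, hn⟩
  exact ⟨((x' : ZMod 12) - (x - n)).val,
    hS.mem_of_color_eq hn (ZMod.val_lt _) hx' (by simp)⟩

lemma comp (hS : IsCircular S) (hT : IsCircular T) :
    IsCircular {p | ∃ z : ℕ, (p.1, z) ∈ S ∧ (z, p.2) ∈ T} where
  fst_lt := by
    rintro x y ⟨z, hz, -⟩
    exact hS.fst_lt hz
  snd_lt := by
    rintro x y ⟨z, -, hz⟩
    exact hT.snd_lt hz
  mem_of_color_eq := by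
    rintro x y x' y' ⟨z, hxz, hzy⟩ hx' hy' hc
    obtain ⟨a, ha, ha'⟩ := exists_circColor_split ((z : ZMod 12) - x) _ _ hc
    refine ⟨((x' : ZMod 12) + a).val, hS.mem_of_color_eq hxz hx' (ZMod.val_lt _) ?_,
      hT.mem_of_color_eq hzy (ZMod.val_lt _) hy' ?_⟩
    · simp [ha]
    · rw [sub_sub_sub_cancel_right] at ha'
      simp [← ha', sub_sub]

lemma union (hS : IsCircular S) (hT : IsCircular T) : IsCircular (S ∪ T) where
  fst_lt := fun h => h.elim hS.fst_lt hT.fst_lt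
  snd_lt := fun h => h.elim hS.snd_lt hT.snd_lt
  mem_of_color_eq := fun h hx hy hc =>
    h.imp (hS.mem_of_color_eq · hx hy hc) (hT.mem_of_color_eq · hx hy hc)

lemma inter (hS : IsCircular S) (hT : IsCircular T) : IsCircular (S ∩ T) where
  fst_lt := fun h => hS.fst_lt h.1
  snd_lt := fun h => hS.snd_lt h.1
  mem_of_color_eq := fun h hx hy hc =>
    ⟨hS.mem_of_color_eq h.1 hx hy hc, hT.mem_of_color_eq h.2 hx hy hc⟩

lemma diff (hS : IsCircular S) (hT : IsCircular T) : IsCircular (S \ T) where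
  fst_lt := fun h => hS.fst_lt h.1
  snd_lt := fun h => hS.snd_lt h.1
  mem_of_color_eq := fun h hx hy hc =>
    ⟨hS.mem_of_color_eq h.1 hx hy hc, fun h' =>
      h.2 (hT.mem_of_color_eq h' (hS.fst_lt h.1) (hS.snd_lt h.1) hc.symm)⟩

end IsCircular

/-- The circulant graph on `{0, …, 11}` in which every label is interpreted by the differences of
colour `1`. -/
def circGraph (Λ : Type) : Graph Λ :=
  fun _ => {p | p.1 < 12 ∧ p.2 < 12 ∧ circColor ((p.2 : ZMod 12) - p.1) = 1}

lemma circGraph_finite (Λ : Type) : (circGraph Λ).Finite := fun _ =>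
  ((Set.finite_Iio 12).prod (Set.finite_Iio 12)).subset fun _ hp => ⟨hp.1, hp.2.1⟩

lemma mem_adom_circGraph {Λ : Type} [Nonempty Λ] {x : ℕ} :
    x ∈ adom (circGraph Λ) ↔ x < 12 := by
  constructor
  · rintro ⟨n, R, h | h⟩
    exacts [h.1, h.2.1]
  · intro hx
    obtain ⟨R⟩ := ‹Nonempty Λ›
    refine ⟨((x : ZMod 12) + 1).val, R, Or.inl ⟨hx, ZMod.val_lt ((x : ZMod 12) + 1), ?_⟩⟩
    simp only [ZMod.natCast_val, ZMod.cast_id', id_eq, add_sub_cancel_left]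
    decide +kernel

lemma isCircular_eval {Λ : Type} [Nonempty Λ] {F : Set Feature} (hF : Feature.conv ∉ F)
    (e : Expr Λ) (he : e.InFrag F) : IsCircular (eval e (circGraph Λ)) := by
  induction e with
  | rel R => exact ⟨fun h => h.1, fun h => h.2.1, fun h hx hy hc => ⟨hx, hy, hc ▸ h.2.2⟩⟩
  | empty => exact ⟨fun h => h.elim, fun h => h.elim, fun h => h.elim⟩
  | id =>
    simpa only [eval, mem_adom_circGraph, and_true] using
      IsCircular.diag (fun _ => True) fun _ _ _ _ h => h
  | comp e₁ e₂ ih₁ ih₂ => exact (ih₁ he.1).comp (ih₂ he.2)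
  | union e₁ e₂ ih₁ ih₂ => exact (ih₁ he.1).union (ih₂ he.2)
  | di =>
    simp only [eval, mem_adom_circGraph]
    refine ⟨fun h => h.1, fun h => h.2.1, fun {x y x' y'} h hx hy hc => ⟨hx, hy, ?_⟩⟩
    rintro (rfl : x' = y')
    exact h.2.2 (eq_of_circColor_eq h.1 h.2.1 hc.symm)
  | conv e ih => exact absurd he.1 hF
  | inter e₁ e₂ ih₁ ih₂ => exact (ih₁ he.2.1).inter (ih₂ he.2.2)
  | diff e₁ e₂ ih₁ ih₂ => exact (ih₁ he.2.1).diff (ih₂ he.2.2)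
  | proj1 e ih =>
    simp only [eval, mem_adom_circGraph]
    exact .diag _ fun x x' _ hx' => (ih he.2).exists_fst x x' hx'
  | proj2 e ih =>
    simp only [eval, mem_adom_circGraph]
    exact .diag _ fun x x' _ hx' => (ih he.2).exists_snd x x' hx'
  | coproj1 e ih =>
    simp only [eval, mem_adom_circGraph]
    exact .diag _ fun x x' hx _ => mt ((ih he.2).exists_fst x' x hx)
  | coproj2 e ih =>
    simp only [eval, mem_adom_circGraph]
    exact .diag _ fun x x' hx _ => mt ((ih he.2).exists_snd x' x hx)

lemma not_isCircular_eval_conv {Λ : Type} (R : Λ) :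
    ¬ IsCircular (eval (.conv (.rel R)) (circGraph Λ)) := by
  intro h
  have h₄ : (0, 4) ∈ eval (.conv (.rel R)) (circGraph Λ) :=
    ⟨by norm_num, by norm_num, by decide +kernel⟩
  have h₆ : (0, 6) ∈ eval (.conv (.rel R)) (circGraph Λ) :=
    h.mem_of_color_eq h₄ (by norm_num) (by norm_num) (by decide +kernel)
  exact absurd h₆.2.2 (by decide +kernel)

/-- Strong separability of path queries implies that the path queries are not subsumed. -/
lemma StrongSepPath.not_leqPath {Λ : Type} {F₁ F₂ : Set Feature} (h : StrongSepPath Λ F₁ F₂) :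
    ¬ leqPath Λ F₁ F₂ := by
  intro hle
  obtain ⟨e₁, G, he₁, -, hne⟩ := h
  obtain ⟨e₂, he₂, heq⟩ := hle e₁ he₁
  exact hne e₂ he₂ (heq G)

/-- if `⁻¹ ∈ F̄₁` and `⁻¹ ∉ F̄₂` then `N(F₁)` is strongly
separable from `N(F₂)` at the level of path queries; in particular
`N(F₁) ≰path N(F₂)`. -/
theorem conv_path_separation (Λ : Type) [Fintype Λ] [Nonempty Λ]
    (F₁ F₂ : Set Feature)
    (h₁ : Feature.conv ∈ closure F₁) (h₂ : Feature.conv ∉ closure F₂) :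
    StrongSepPath Λ F₁ F₂ ∧ ¬ leqPath Λ F₁ F₂ := by
  obtain ⟨R⟩ := ‹Nonempty Λ›
  have : Nonempty Λ := ⟨R⟩
  have hsep : StrongSepPath Λ F₁ F₂ := by
    refine ⟨.conv (.rel R), circGraph Λ, ⟨conv_mem_of_conv_mem_closure h₁, trivial⟩,
      circGraph_finite Λ, fun e₂ he₂ heq => not_isCircular_eval_conv R ?_⟩
    exact heq ▸ isCircular_eval (fun h => h₂ (.base h)) e₂ he₂
  exact ⟨hsep, hsep.not_leqPath⟩

end NavGraph
end

section
/- Let F1 and F2 be sets of nonbasic features with π ∈ F̄1 and F2 ⊆ {⁻¹, di}. Then N(F1) ≰bool N(F2): there exists a boolean query expressible in N(F1) that is not expressible in N(F2). -/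
namespace NavGraph

section

variable {Λ : Type}

theorem eval_subset_adom (e : Expr Λ) (G : Graph Λ) {m n : ℕ} (h : (m, n) ∈ eval e G) :
    m ∈ adom G ∧ n ∈ adom G := by
  induction e generalizing m n with
  | rel R => exact ⟨⟨n, R, Or.inl h⟩, ⟨m, R, Or.inr h⟩⟩
  | empty => exact h.elim
  | id => obtain ⟨h, h'⟩ := h; simp only at h h'; subst h; exact ⟨h', h'⟩
  | comp e₁ e₂ ih₁ ih₂ => obtain ⟨z, hz, hz'⟩ := h; exact ⟨(ih₁ hz).1, (ih₂ hz').2⟩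
  | union e₁ e₂ ih₁ ih₂ => exact h.elim (fun h => ih₁ h) (fun h => ih₂ h)
  | di => exact ⟨h.1, h.2.1⟩
  | conv e ih => exact (ih h).symm
  | inter e₁ e₂ ih₁ ih₂ => exact ih₁ h.1
  | diff e₁ e₂ ih₁ ih₂ => exact ih₁ h.1
  | proj1 e ih => obtain ⟨h, h', -⟩ := h; simp only at h h'; subst h; exact ⟨h', h'⟩
  | proj2 e ih => obtain ⟨h, h', -⟩ := h; simp only at h h'; subst h; exact ⟨h', h'⟩
  | coproj1 e ih => obtain ⟨h, h', -⟩ := h; simp only at h h'; subst h; exact ⟨h', h'⟩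
  | coproj2 e ih => obtain ⟨h, h', -⟩ := h; simp only at h h'; subst h; exact ⟨h', h'⟩

/-- The expression `e` has an equivalent one in `N(F)`. -/
def Expr.Definable (F : Set Feature) (e : Expr Λ) : Prop :=
  ∃ e' : Expr Λ, e'.InFrag F ∧ ∀ G : Graph Λ, eval e' G = eval e G

/-- The operators of a feature preserve definability in `N(F)`. -/
def PreservesDefinable (Λ : Type) (F : Set Feature) : Feature → Prop
  | .di => (Expr.di : Expr Λ).Definable F
  | .conv => ∀ e : Expr Λ, e.Definable F → (Expr.conv e).Definable F
  | .inter => ∀ e₁ e₂ : Expr Λ, e₁.Definable F → e₂.Definable F → (Expr.inter e₁ e₂).Definable F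
  | .diff => ∀ e₁ e₂ : Expr Λ, e₁.Definable F → e₂.Definable F → (Expr.diff e₁ e₂).Definable F
  | .proj => ∀ e : Expr Λ, e.Definable F →
      (Expr.proj1 e).Definable F ∧ (Expr.proj2 e).Definable F
  | .coproj => ∀ e : Expr Λ, e.Definable F →
      (Expr.coproj1 e).Definable F ∧ (Expr.coproj2 e).Definable F

namespace Expr.Definable

variable {F : Set Feature} {e e₁ e₂ : Expr Λ}

theorem of_eval_eq (h : e₁.Definable F) (h' : ∀ G : Graph Λ, eval e₁ G = eval e₂ G) :
    e₂.Definable F := by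
  obtain ⟨e, he, hG⟩ := h
  exact ⟨e, he, fun G => (hG G).trans (h' G)⟩

theorem of_inFrag (h : e.InFrag F) : e.Definable F := ⟨e, h, fun _ => rfl⟩

theorem comp (h₁ : e₁.Definable F) (h₂ : e₂.Definable F) : (Expr.comp e₁ e₂).Definable F := by
  obtain ⟨e₁', h₁, hG₁⟩ := h₁
  obtain ⟨e₂', h₂, hG₂⟩ := h₂
  exact ⟨.comp e₁' e₂', ⟨h₁, h₂⟩, fun G => by simp only [eval, hG₁, hG₂]⟩

theorem union (h₁ : e₁.Definable F) (h₂ : e₂.Definable F) : (Expr.union e₁ e₂).Definable F := by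
  obtain ⟨e₁', h₁, hG₁⟩ := h₁
  obtain ⟨e₂', h₂, hG₂⟩ := h₂
  exact ⟨.union e₁' e₂', ⟨h₁, h₂⟩, fun G => by simp only [eval, hG₁, hG₂]⟩

theorem id : (Expr.id : Expr Λ).Definable F := of_inFrag trivial

end Expr.Definable

theorem preservesDefinable_of_mem {F : Set Feature} {x : Feature} (hx : x ∈ F) :
    PreservesDefinable Λ F x := by
  cases x with
  | di => exact ⟨.di, hx, fun _ => rfl⟩
  | conv =>
    rintro e ⟨e', h, hG⟩
    exact ⟨.conv e', ⟨hx, h⟩, fun G => by simp only [eval, hG]⟩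
  | inter =>
    rintro e₁ e₂ ⟨e₁', h₁, hG₁⟩ ⟨e₂', h₂, hG₂⟩
    exact ⟨.inter e₁' e₂', ⟨hx, h₁, h₂⟩, fun G => by simp only [eval, hG₁, hG₂]⟩
  | diff =>
    rintro e₁ e₂ ⟨e₁', h₁, hG₁⟩ ⟨e₂', h₂, hG₂⟩
    exact ⟨.diff e₁' e₂', ⟨hx, h₁, h₂⟩, fun G => by simp only [eval, hG₁, hG₂]⟩
  | proj =>
    rintro e ⟨e', h, hG⟩
    exact ⟨⟨.proj1 e', ⟨hx, h⟩, fun G => by simp only [eval, hG]⟩,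
      ⟨.proj2 e', ⟨hx, h⟩, fun G => by simp only [eval, hG]⟩⟩
  | coproj =>
    rintro e ⟨e', h, hG⟩
    exact ⟨⟨.coproj1 e', ⟨hx, h⟩, fun G => by simp only [eval, hG]⟩,
      ⟨.coproj2 e', ⟨hx, h⟩, fun G => by simp only [eval, hG]⟩⟩

theorem eval_coproj_coproj (e : Expr Λ) (G : Graph Λ) :
    eval (.coproj1 (.coproj1 e)) G = eval (.proj1 e) G ∧
      eval (.coproj2 (.coproj2 e)) G = eval (.proj2 e) G := by
  constructor <;> ext ⟨m, n⟩ <;> simp only [eval, Set.mem_ofPred_eq] <;> grind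

theorem eval_inter_di (e : Expr Λ) (G : Graph Λ) :
    eval (.inter (.comp e (.union .id .di)) .id) G = eval (.proj1 e) G ∧
      eval (.inter (.comp (.union .id .di) e) .id) G = eval (.proj2 e) G := by
  have h := @eval_subset_adom _ e G
  constructor <;> ext ⟨m, n⟩ <;>
    simp only [eval, Set.mem_ofPred_eq, Set.mem_inter_iff, Set.mem_union] <;> grind

theorem eval_inter_conv (e : Expr Λ) (G : Graph Λ) :
    eval (.inter (.comp e (.conv e)) .id) G = eval (.proj1 e) G ∧
      eval (.inter (.comp (.conv e) e) .id) G = eval (.proj2 e) G := by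
  constructor <;> ext ⟨m, n⟩ <;>
    simp only [eval, Set.mem_ofPred_eq, Set.mem_inter_iff] <;> grind

theorem eval_diff_proj (e : Expr Λ) (G : Graph Λ) :
    eval (.diff .id (.proj1 e)) G = eval (.coproj1 e) G ∧
      eval (.diff .id (.proj2 e)) G = eval (.coproj2 e) G := by
  constructor <;> ext ⟨m, n⟩ <;>
    simp only [eval, Set.mem_ofPred_eq, Set.mem_sdiff] <;> grind

theorem eval_diff_diff (e₁ e₂ : Expr Λ) (G : Graph Λ) :
    eval (.diff e₁ (.diff e₁ e₂)) G = eval (.inter e₁ e₂) G :=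
  Set.sdiff_sdiff_right_self _ _

theorem InClosure.preservesDefinable {F : Set Feature} {x : Feature} (hx : InClosure F x) :
    PreservesDefinable Λ F x := by
  induction hx with
  | base h => exact preservesDefinable_of_mem h
  | proj_of_coproj _ ih =>
    intro e he
    exact ⟨(ih _ (ih e he).1).1.of_eval_eq fun G => (eval_coproj_coproj e G).1,
      (ih _ (ih e he).2).2.of_eval_eq fun G => (eval_coproj_coproj e G).2⟩
  | proj_of_inter_di _ _ ihi ihd =>
    intro e he
    exact ⟨(ihi _ _ (he.comp (.union .id ihd)) .id).of_eval_eq fun G => (eval_inter_di e G).1,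
      (ihi _ _ (.comp (.union .id ihd) he) .id).of_eval_eq fun G => (eval_inter_di e G).2⟩
  | proj_of_inter_conv _ _ ihi ihc =>
    intro e he
    exact ⟨(ihi _ _ (he.comp (ihc e he)) .id).of_eval_eq fun G => (eval_inter_conv e G).1,
      (ihi _ _ (.comp (ihc e he) he) .id).of_eval_eq fun G => (eval_inter_conv e G).2⟩
  | coproj_of_diff_proj _ _ ihd ihp =>
    intro e he
    exact ⟨(ihd _ _ .id (ihp e he).1).of_eval_eq fun G => (eval_diff_proj e G).1,
      (ihd _ _ .id (ihp e he).2).of_eval_eq fun G => (eval_diff_proj e G).2⟩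
  | inter_of_diff _ ih =>
    intro e₁ e₂ h₁ h₂
    exact (ih _ _ h₁ (ih _ _ h₁ h₂)).of_eval_eq (eval_diff_diff e₁ e₂)

/-- A position in a finite sequence of nodes: the reversed past, the current node and
the future. -/
abbrev Zipper : Type := List ℕ × ℕ × List ℕ

/-- `x.Next y` holds if `y` is obtained from `x` by moving one step to the right. -/
inductive Zipper.Next : Zipper → Zipper → Prop
  | mk (p : List ℕ) (a b : ℕ) (L : List ℕ) : Next (p, a, b :: L) (a :: p, b, L)

theorem Zipper.Next.right_unique {x y y' : Zipper} (h : x.Next y) (h' : x.Next y') : y = y' := by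
  cases h; cases h'; rfl

theorem Zipper.Next.left_unique {x x' y : Zipper} (h : x.Next y) (h' : x'.Next y) : x = x' := by
  cases h; cases h'; rfl

/-- An arbitrary identification of nodes and positions. -/
def toZipper : ℕ ≃ Zipper := (Denumerable.eqv Zipper).symm

/-- The disjoint union of all finite paths equipped with a homomorphism to `T`. -/
def pathCover (T : Graph Λ) : Graph Λ := fun R =>
  {p | ((toZipper p.1).Next (toZipper p.2) ∨ (toZipper p.2).Next (toZipper p.1)) ∧
    ((toZipper p.1).2.1, (toZipper p.2).2.1) ∈ T R}

/-- The node of `pathCover T` given by a position. -/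
def zipperNode (p : List ℕ) (a : ℕ) (L : List ℕ) : ℕ := toZipper.symm (p, a, L)

theorem pathCover_forward {T : Graph Λ} {R : Λ} {a b : ℕ} (h : (a, b) ∈ T R) (p L : List ℕ) :
    (zipperNode p a (b :: L), zipperNode (a :: p) b L) ∈ pathCover T R := by
  simpa [pathCover, zipperNode, h] using Or.inl (Zipper.Next.mk p a b L)

theorem pathCover_backward {T : Graph Λ} {R : Λ} {a b : ℕ} (h : (b, a) ∈ T R) (p L : List ℕ) :
    (zipperNode (a :: p) b L, zipperNode p a (b :: L)) ∈ pathCover T R := by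
  simpa [pathCover, zipperNode, h] using Or.inr (Zipper.Next.mk p a b L)

theorem exists_zipperNode_mem_adom {T : Graph Λ} {b : ℕ} (hb : b ∈ adom T) (L : List ℕ) :
    ∃ q, zipperNode q b L ∈ adom (pathCover T) := by
  obtain ⟨a, R, h | h⟩ := hb
  · exact ⟨[a], _, R, Or.inl (pathCover_backward h [] L)⟩
  · exact ⟨[a], _, R, Or.inr (pathCover_forward h [] L)⟩

theorem zipperNode_ne {a b : ℕ} (h : a ≠ b) (p q L M : List ℕ) :
    zipperNode p a L ≠ zipperNode q b M := by
  simp [zipperNode, h]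

/-- Pairs defined by an expression using only converse and diversity lift to `pathCover T`,
in both directions and with prescribed future at the target. -/
theorem exists_lift {F : Set Feature} (hF : F ⊆ {Feature.conv, Feature.di}) (T : Graph Λ)
    (e : Expr Λ) (he : e.InFrag F) :
    (∀ a b, (a, b) ∈ eval e T → ∀ L, ∃ L', ∀ p, zipperNode p a L' ∈ adom (pathCover T) →
      ∃ q, zipperNode q b L ∈ adom (pathCover T) ∧
        (zipperNode p a L', zipperNode q b L) ∈ eval e (pathCover T)) ∧
    (∀ a b, (b, a) ∈ eval e T → ∀ L, ∃ L', ∀ p, zipperNode p a L' ∈ adom (pathCover T) →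
      ∃ q, zipperNode q b L ∈ adom (pathCover T) ∧
        (zipperNode q b L, zipperNode p a L') ∈ eval e (pathCover T)) := by
  have hi : Feature.inter ∉ F := fun h => by simpa using hF h
  have hd : Feature.diff ∉ F := fun h => by simpa using hF h
  have hp : Feature.proj ∉ F := fun h => by simpa using hF h
  have hc : Feature.coproj ∉ F := fun h => by simpa using hF h
  induction e with
  | rel R =>
    refine ⟨fun a b h L => ⟨b :: L, fun p _ => ⟨a :: p, ?_, pathCover_forward h p L⟩⟩,
      fun a b h L => ⟨b :: L, fun p _ => ⟨a :: p, ?_, pathCover_backward h p L⟩⟩⟩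
    · exact ⟨_, R, Or.inr (pathCover_forward h p L)⟩
    · exact ⟨_, R, Or.inl (pathCover_backward h p L)⟩
  | empty => exact ⟨fun _ _ h => h.elim, fun _ _ h => h.elim⟩
  | id =>
    constructor <;> rintro a b ⟨h, -⟩ L <;> simp only at h <;> subst h <;>
      exact ⟨L, fun p hp => ⟨p, hp, rfl, hp⟩⟩
  | comp e₁ e₂ ih₁ ih₂ =>
    constructor
    · rintro a b ⟨z, h₁, h₂⟩ L
      obtain ⟨M, hM⟩ := (ih₂ he.2).1 z b h₂ L
      obtain ⟨L', hL'⟩ := (ih₁ he.1).1 a z h₁ M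
      refine ⟨L', fun p hp => ?_⟩
      obtain ⟨r, hr, hr'⟩ := hL' p hp
      obtain ⟨q, hq, hq'⟩ := hM r hr
      exact ⟨q, hq, _, hr', hq'⟩
    · rintro a b ⟨z, h₁, h₂⟩ L
      obtain ⟨M, hM⟩ := (ih₁ he.1).2 z b h₁ L
      obtain ⟨L', hL'⟩ := (ih₂ he.2).2 a z h₂ M
      refine ⟨L', fun p hp => ?_⟩
      obtain ⟨r, hr, hr'⟩ := hL' p hp
      obtain ⟨q, hq, hq'⟩ := hM r hr
      exact ⟨q, hq, _, hq', hr'⟩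
  | union e₁ e₂ ih₁ ih₂ =>
    constructor
    · rintro a b (h | h) L
      · obtain ⟨L', hL'⟩ := (ih₁ he.1).1 a b h L
        exact ⟨L', fun p hp => (hL' p hp).imp fun _ hq => ⟨hq.1, Or.inl hq.2⟩⟩
      · obtain ⟨L', hL'⟩ := (ih₂ he.2).1 a b h L
        exact ⟨L', fun p hp => (hL' p hp).imp fun _ hq => ⟨hq.1, Or.inr hq.2⟩⟩
    · rintro a b (h | h) L
      · obtain ⟨L', hL'⟩ := (ih₁ he.1).2 a b h L
        exact ⟨L', fun p hp => (hL' p hp).imp fun _ hq => ⟨hq.1, Or.inl hq.2⟩⟩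
      · obtain ⟨L', hL'⟩ := (ih₂ he.2).2 a b h L
        exact ⟨L', fun p hp => (hL' p hp).imp fun _ hq => ⟨hq.1, Or.inr hq.2⟩⟩
  | di =>
    constructor
    · rintro a b ⟨-, hb, hab⟩ L
      obtain ⟨q, hq⟩ := exists_zipperNode_mem_adom hb L
      exact ⟨[], fun p hp => ⟨q, hq, hp, hq, zipperNode_ne hab _ _ _ _⟩⟩
    · rintro a b ⟨hb, -, hab⟩ L
      obtain ⟨q, hq⟩ := exists_zipperNode_mem_adom hb L
      exact ⟨[], fun p hp => ⟨q, hq, hq, hp, zipperNode_ne hab _ _ _ _⟩⟩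
  | conv e ih => exact ⟨(ih he.2).2, (ih he.2).1⟩
  | inter => exact absurd he.1 hi
  | diff => exact absurd he.1 hd
  | proj1 => exact absurd he.1 hp
  | proj2 => exact absurd he.1 hp
  | coproj1 => exact absurd he.1 hc
  | coproj2 => exact absurd he.1 hc

theorem eval_pathCover_nonempty {F : Set Feature} (hF : F ⊆ {Feature.conv, Feature.di})
    {T : Graph Λ} {e : Expr Λ} (he : e.InFrag F) (h : (eval e T).Nonempty) :
    (eval e (pathCover T)).Nonempty := by
  obtain ⟨⟨a, b⟩, hab⟩ := h
  obtain ⟨L, hL⟩ := (exists_lift hF T e he).1 a b hab []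
  obtain ⟨p, hp⟩ := exists_zipperNode_mem_adom (eval_subset_adom e T hab).1 L
  obtain ⟨q, -, hq⟩ := hL p hp
  exact ⟨_, hq⟩

theorem pathCover_map {T : Graph Λ} {R : Λ} {m n : ℕ} (h : (m, n) ∈ pathCover T R) :
    ((toZipper m).2.1, (toZipper n).2.1) ∈ T R := h.2

/-- Every node of `pathCover T` has at most two neighbours. -/
theorem pathCover_neighbour_eq {T : Graph Λ} {R : Λ} {x y₁ y₂ y₃ : ℕ}
    (h₁ : (y₁, x) ∈ pathCover T R) (h₂ : (x, y₂) ∈ pathCover T R)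
    (h₃ : (x, y₃) ∈ pathCover T R) : y₁ = y₂ ∨ y₁ = y₃ ∨ y₂ = y₃ := by
  have hr {x y y' : ℕ} (h : (toZipper x).Next (toZipper y))
      (h' : (toZipper x).Next (toZipper y')) : y = y' := toZipper.injective (h.right_unique h')
  have hl {x y y' : ℕ} (h : (toZipper y).Next (toZipper x))
      (h' : (toZipper y').Next (toZipper x)) : y = y' := toZipper.injective (h.left_unique h')
  obtain ⟨h₁ | h₁, -⟩ := h₁ <;> obtain ⟨h₂ | h₂, -⟩ := h₂ <;> obtain ⟨h₃ | h₃, -⟩ := h₃ <;>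
    simp only at h₁ h₂ h₃ <;>
    first
    | exact Or.inl (hr h₁ h₂)
    | exact Or.inl (hl h₁ h₂)
    | exact Or.inr (Or.inl (hr h₁ h₃))
    | exact Or.inr (Or.inl (hl h₁ h₃))
    | exact Or.inr (Or.inr (hr h₂ h₃))
    | exact Or.inr (Or.inr (hl h₂ h₃))

/-- An oriented tree in which the node `1` has degree three and which does not map
homomorphically to any oriented path mapping to it. -/
def triad (Λ : Type) : Graph Λ := fun _ =>
  {(0, 1), (1, 2), (2, 3), (1, 4), (5, 6), (6, 7), (7, 4)}

/-- The query `R ∘ π₁(R ∘ R) ∘ R ∘ π₂(R ∘ R ∘ R)`, satisfied by the graphs to which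
`triad` maps. -/
def triadQuery (R : Λ) : Expr Λ :=
  .comp (.rel R) (.comp (.proj1 (.comp (.rel R) (.rel R)))
    (.comp (.rel R) (.proj2 (.comp (.rel R) (.comp (.rel R) (.rel R))))))

theorem triadQuery_nonempty_iff (R : Λ) (G : Graph Λ) :
    (eval (triadQuery R) G).Nonempty ↔ ∃ z c y p y' w₁ w₂ w₃, (z, c) ∈ G R ∧ (c, y) ∈ G R ∧
      (y, p) ∈ G R ∧ (c, y') ∈ G R ∧ (w₁, y') ∈ G R ∧ (w₂, w₁) ∈ G R ∧ (w₃, w₂) ∈ G R := by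
  constructor
  · rintro ⟨⟨z, t⟩, c, hzc, c', ⟨hc, -, p, y, hcy, hyp⟩, y', hcy', hy', -, w₃, w₂, h₃, w₁, h₂, h₁⟩
    simp only at hc hy'
    subst hc hy'
    exact ⟨z, c, y, p, y', w₁, w₂, w₃, hzc, hcy, hyp, hcy', h₁, h₂, h₃⟩
  · rintro ⟨z, c, y, p, y', w₁, w₂, w₃, hzc, hcy, hyp, hcy', h₁, h₂, h₃⟩
    exact ⟨(z, y'), c, hzc, c, ⟨rfl, ⟨_, R, Or.inl hcy⟩, p, y, hcy, hyp⟩, y', hcy', rfl,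
      ⟨_, R, Or.inr hcy'⟩, w₃, w₂, h₃, w₁, h₂, h₁⟩

theorem triadQuery_triad (R : Λ) : (eval (triadQuery R) (triad Λ)).Nonempty := by
  rw [triadQuery_nonempty_iff]
  exact ⟨0, 1, 2, 3, 4, 7, 6, 5, by simp [triad]⟩

theorem triad_asymm {R : Λ} {a b : ℕ} (h : (a, b) ∈ triad Λ R) : (b, a) ∉ triad Λ R := by
  simp only [triad, Set.mem_insert_iff, Set.mem_singleton_iff, Prod.mk.injEq] at h ⊢
  omega

theorem triad_no_long_path {R : Λ} {a b c d e : ℕ} (h₁ : (a, b) ∈ triad Λ R)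
    (h₂ : (b, c) ∈ triad Λ R) (h₃ : (c, d) ∈ triad Λ R) : (d, e) ∉ triad Λ R := by
  simp only [triad, Set.mem_insert_iff, Set.mem_singleton_iff, Prod.mk.injEq] at h₁ h₂ h₃ ⊢
  omega

theorem triadQuery_pathCover (R : Λ) : ¬ (eval (triadQuery R) (pathCover (triad Λ))).Nonempty := by
  rw [triadQuery_nonempty_iff]
  rintro ⟨z, c, y, p, y', w₁, w₂, w₃, hzc, hcy, hyp, hcy', h₁, h₂, h₃⟩
  obtain rfl | rfl | rfl := pathCover_neighbour_eq hzc hcy hcy'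
  · exact triad_asymm (pathCover_map hzc) (pathCover_map hcy)
  · exact triad_asymm (pathCover_map hzc) (pathCover_map hcy')
  · exact triad_no_long_path (pathCover_map h₃) (pathCover_map h₂) (pathCover_map h₁)
      (pathCover_map hyp)

theorem triadQuery_definable {F : Set Feature} (h : Feature.proj ∈ closure F) (R : Λ) :
    (triadQuery R).Definable F := by
  have hπ : PreservesDefinable Λ F .proj := InClosure.preservesDefinable h
  have hR : (Expr.rel R).Definable F := .of_inFrag trivial
  exact hR.comp ((hπ _ (hR.comp hR)).1.comp (hR.comp (hπ _ (hR.comp (hR.comp hR))).2))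

end

/-- if `π ∈ F̄₁` and `F₂ ⊆ {⁻¹, di}` then `N(F₁) ≰bool N(F₂)`. -/
theorem proj_vs_conv_di (Λ : Type) [Fintype Λ] [Nonempty Λ]
    (F₁ F₂ : Set Feature) (h₁ : Feature.proj ∈ closure F₁)
    (h₂ : F₂ ⊆ {Feature.conv, Feature.di}) :
    ¬ leqBool Λ F₁ F₂ := by
  intro hle
  obtain ⟨R⟩ := ‹Nonempty Λ›
  obtain ⟨e₁, he₁, hG⟩ := triadQuery_definable h₁ R
  obtain ⟨e₂, he₂, hiff⟩ := hle e₁ he₁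
  simp only [hG] at hiff
  exact triadQuery_pathCover R ((hiff _).1
    (eval_pathCover_nonempty h₂ he₂ ((hiff _).2 (triadQuery_triad R))))

end NavGraph
end

section
/- Let F1 and F2 be sets of nonbasic features with ∖ ∈ F̄1 and ∖ ∉ F̄2. Then N(F1) is strongly separable from N(F2) at the level of boolean queries; in particular N(F1) ≰bool N(F2). Concretely, the 3-clique with a self-loop on every node and the bow-tie consisting of two 3-cliques sharing one node with a self-loop on every node (all edges labeled R) are distinguishable in N(F1), by the boolean query expressed by R² ∖ R, but indistinguishable in N(F2). -/
namespace NavGraph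

/-- The 3-clique on nodes `{0,1,2}` with a self-loop on every node (all edges
labeled `R`). -/
def clique3 (Λ : Type) [DecidableEq Λ] (R : Λ) : Graph Λ :=
  fun S => if S = R then {p : ℕ × ℕ | p.1 ≤ 2 ∧ p.2 ≤ 2} else ∅

/-- The bow-tie: two 3-cliques on `{0,1,2}` and `{2,3,4}` sharing the node `2`,
with a self-loop on every node (all edges labeled `R`). -/
def bowtie (Λ : Type) [DecidableEq Λ] (R : Λ) : Graph Λ :=
  fun S => if S = R then
    {p : ℕ × ℕ | (p.1 ≤ 2 ∧ p.2 ≤ 2) ∨ (2 ≤ p.1 ∧ p.1 ≤ 4 ∧ 2 ≤ p.2 ∧ p.2 ≤ 4)}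
  else ∅

/-- Two nodes are adjacent if some edge, of any label, joins the first to the second. -/
def Adj {Λ : Type} (G : Graph Λ) (a b : ℕ) : Prop := ∃ R : Λ, (a, b) ∈ G R

/-- A graph is triangulated if adjacency is symmetric, every endpoint of an edge has a
self-loop, and every two adjacent nodes have a common neighbor distinct from both. -/
structure Triangulated {Λ : Type} (G : Graph Λ) : Prop where
  symm : ∀ {a b : ℕ}, Adj G a b → Adj G b a
  loop : ∀ {a b : ℕ}, Adj G a b → Adj G a a
  third : ∀ {a b : ℕ}, Adj G a b → ∃ c, Adj G a c ∧ Adj G c b ∧ a ≠ c ∧ c ≠ b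

/-- Every pair of `H`-adjacent nodes with the equality type of some pair in `A` lies in `B`. -/
def Transfers {Λ : Type} (H : Graph Λ) (A B : Set (ℕ × ℕ)) : Prop :=
  ∀ ⦃x y a b : ℕ⦄, (x, y) ∈ A → Adj H a b → (x = y ↔ a = b) → (a, b) ∈ B

namespace Triangulated

variable {Λ : Type} {G H : Graph Λ}

theorem mem_adom_iff (hG : Triangulated G) {a : ℕ} : a ∈ adom G ↔ Adj G a a := by
  constructor
  · rintro ⟨n, S, h | h⟩
    · exact hG.loop ⟨S, h⟩
    · exact hG.loop (hG.symm ⟨S, h⟩)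
  · rintro ⟨S, h⟩
    exact ⟨a, S, Or.inl h⟩

theorem exists_between (hG : Triangulated G) {a b x y : ℕ} (hab : Adj G a b)
    (hxy : x = y ↔ a = b) (z : ℕ) :
    ∃ c, Adj G a c ∧ Adj G c b ∧ (x = z ↔ a = c) ∧ (z = y ↔ c = b) := by
  by_cases hx : x = z
  · subst hx
    exact ⟨a, hG.loop hab, hab, by simp, hxy⟩
  by_cases hy : z = y
  · subst hy
    exact ⟨b, hab, hG.loop (hG.symm hab), hxy, by simp⟩
  obtain ⟨c, hac, hcb, h1, h2⟩ := hG.third hab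
  exact ⟨c, hac, hcb, by simp [hx, h1], by simp [hy, h2]⟩

theorem exists_adj (hG : Triangulated G) {a : ℕ} (ha : a ∈ adom G) (x y : ℕ) :
    ∃ b, Adj G a b ∧ (x = y ↔ a = b) := by
  obtain ⟨b, hab, -, h, -⟩ :=
    hG.exists_between (x := x) (y := x) (hG.mem_adom_iff.1 ha) (by simp) y
  exact ⟨b, hab, h⟩

/-- If edges transfer between two triangulated graphs in both directions, then so do the
relations defined by difference-free expressions. -/
theorem transfers_eval {F : Set Feature} (hF : Feature.diff ∉ F) (e : Expr Λ)
    (he : e.InFrag F) (hG : Triangulated G) (hH : Triangulated H)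
    (hGH : ∀ S, Transfers H (G S) (H S)) (hHG : ∀ S, Transfers G (H S) (G S)) :
    Transfers H (eval e G) (eval e H) := by
  induction e generalizing G H with
  | rel S => exact hGH S
  | empty => exact fun _ _ _ _ h => h.elim
  | id =>
    rintro x y a b ⟨h, -⟩ hab hxy
    exact ⟨hxy.1 h, hH.mem_adom_iff.2 (hH.loop hab)⟩
  | di =>
    rintro x y a b ⟨-, -, h⟩ hab hxy
    exact ⟨hH.mem_adom_iff.2 (hH.loop hab), hH.mem_adom_iff.2 (hH.loop (hH.symm hab)),
      mt hxy.2 h⟩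
  | comp e₁ e₂ ih₁ ih₂ =>
    rintro x y a b ⟨z, h₁, h₂⟩ hab hxy
    obtain ⟨c, hac, hcb, hxz, hzy⟩ := hH.exists_between hab hxy z
    exact ⟨c, ih₁ he.1 hG hH hGH hHG h₁ hac hxz, ih₂ he.2 hG hH hGH hHG h₂ hcb hzy⟩
  | union e₁ e₂ ih₁ ih₂ =>
    rintro x y a b (h | h) hab hxy
    · exact Or.inl (ih₁ he.1 hG hH hGH hHG h hab hxy)
    · exact Or.inr (ih₂ he.2 hG hH hGH hHG h hab hxy)
  | conv e ih =>
    intro x y a b h hab hxy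
    exact ih he.2 hG hH hGH hHG h (hH.symm hab) (by rw [eq_comm, hxy, eq_comm])
  | inter e₁ e₂ ih₁ ih₂ =>
    rintro x y a b ⟨h₁, h₂⟩ hab hxy
    exact ⟨ih₁ he.2.1 hG hH hGH hHG h₁ hab hxy, ih₂ he.2.2 hG hH hGH hHG h₂ hab hxy⟩
  | diff => exact absurd he.1 hF
  | proj1 e ih =>
    rintro x y a b ⟨h, -, n, hn⟩ hab hxy
    have ha := hH.mem_adom_iff.2 (hH.loop hab)
    obtain ⟨c, hac, hc⟩ := hH.exists_adj ha x n
    exact ⟨hxy.1 h, ha, c, ih he.2 hG hH hGH hHG hn hac hc⟩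
  | proj2 e ih =>
    rintro x y a b ⟨h, -, n, hn⟩ hab hxy
    have ha := hH.mem_adom_iff.2 (hH.loop hab)
    obtain ⟨c, hac, hc⟩ := hH.exists_adj ha x n
    exact ⟨hxy.1 h, ha, c,
      ih he.2 hG hH hGH hHG hn (hH.symm hac) (by rw [eq_comm, hc, eq_comm])⟩
  | coproj1 e ih =>
    rintro x y a b ⟨h, hx, hn⟩ hab hxy
    refine ⟨hxy.1 h, hH.mem_adom_iff.2 (hH.loop hab), fun ⟨n, han⟩ => hn ?_⟩
    obtain ⟨c, hxc, hc⟩ := hG.exists_adj hx a n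
    exact ⟨c, ih he.2 hH hG hHG hGH han hxc hc⟩
  | coproj2 e ih =>
    rintro x y a b ⟨h, hx, hn⟩ hab hxy
    refine ⟨hxy.1 h, hH.mem_adom_iff.2 (hH.loop hab), fun ⟨n, hna⟩ => hn ?_⟩
    obtain ⟨c, hxc, hc⟩ := hG.exists_adj hx a n
    exact ⟨c, ih he.2 hH hG hHG hGH hna (hG.symm hxc) (by rw [eq_comm, hc, eq_comm])⟩

theorem nonempty_of_transfers (hG : Triangulated G) (hne : (adom G).Nonempty)
    {A B : Set (ℕ × ℕ)} (h : Transfers G A B) (hA : A.Nonempty) : B.Nonempty := by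
  obtain ⟨⟨x, y⟩, hxy⟩ := hA
  obtain ⟨a, ha⟩ := hne
  obtain ⟨b, hab, heq⟩ := hG.exists_adj ha x y
  exact ⟨(a, b), h hxy hab heq⟩

end Triangulated

section Witnesses

variable {Λ : Type} [DecidableEq Λ] {R S : Λ} {a b : ℕ}

theorem mem_clique3 : (a, b) ∈ clique3 Λ R S ↔ S = R ∧ a ≤ 2 ∧ b ≤ 2 := by
  unfold clique3
  split_ifs with h <;> simp [h]

theorem mem_bowtie : (a, b) ∈ bowtie Λ R S ↔
    S = R ∧ ((a ≤ 2 ∧ b ≤ 2) ∨ (2 ≤ a ∧ a ≤ 4 ∧ 2 ≤ b ∧ b ≤ 4)) := by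
  unfold bowtie
  split_ifs with h <;> simp [h]

theorem adj_clique3 : Adj (clique3 Λ R) a b ↔ a ≤ 2 ∧ b ≤ 2 := by
  simp [Adj, mem_clique3]

theorem adj_bowtie : Adj (bowtie Λ R) a b ↔
    (a ≤ 2 ∧ b ≤ 2) ∨ (2 ≤ a ∧ a ≤ 4 ∧ 2 ≤ b ∧ b ≤ 4) := by
  simp [Adj, mem_bowtie]

theorem exists_third {a b : ℕ} (ha : a ≤ 2) (hb : b ≤ 2) : ∃ c ≤ 2, a ≠ c ∧ c ≠ b := by
  interval_cases a <;> interval_cases b <;> decide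

theorem triangulated_clique3 (R : Λ) : Triangulated (clique3 Λ R) where
  symm := by simp only [adj_clique3]; omega
  loop := by simp only [adj_clique3]; omega
  third := by
    simp only [adj_clique3]
    rintro a b ⟨ha, hb⟩
    obtain ⟨c, hc, h⟩ := exists_third ha hb
    exact ⟨c, ⟨ha, hc⟩, ⟨hc, hb⟩, h⟩

theorem triangulated_bowtie (R : Λ) : Triangulated (bowtie Λ R) where
  symm := by simp only [adj_bowtie]; omega
  loop := by simp only [adj_bowtie]; omega
  third := by
    simp only [adj_bowtie]
    rintro a b (⟨ha, hb⟩ | ⟨ha, ha', hb, hb'⟩)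
    · obtain ⟨c, hc, h⟩ := exists_third ha hb
      exact ⟨c, Or.inl ⟨ha, hc⟩, Or.inl ⟨hc, hb⟩, h⟩
    · obtain ⟨c, hc, h⟩ := exists_third (a := a - 2) (b := b - 2) (by omega) (by omega)
      exact ⟨c + 2, by omega⟩

theorem transfers_clique3_bowtie (R S : Λ) :
    Transfers (bowtie Λ R) (clique3 Λ R S) (bowtie Λ R S) := by
  intro x y a b h hab _
  exact mem_bowtie.2 ⟨(mem_clique3.1 h).1, adj_bowtie.1 hab⟩

theorem transfers_bowtie_clique3 (R S : Λ) :
    Transfers (clique3 Λ R) (bowtie Λ R S) (clique3 Λ R S) := by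
  intro x y a b h hab _
  exact mem_clique3.2 ⟨(mem_bowtie.1 h).1, adj_clique3.1 hab⟩

theorem clique3_finite (R : Λ) : (clique3 Λ R).Finite := fun S =>
  ((Set.finite_Iic 2).prod (Set.finite_Iic 2)).subset fun ⟨a, b⟩ h => by
    simpa using (mem_clique3.1 h).2

theorem bowtie_finite (R : Λ) : (bowtie Λ R).Finite := fun S =>
  ((Set.finite_Iic 4).prod (Set.finite_Iic 4)).subset fun ⟨a, b⟩ h => by
    have := (mem_bowtie.1 h).2
    simp only [Set.mem_prod, Set.mem_Iic]
    omega

theorem nonempty_eval_bowtie_iff (R : Λ) {F : Set Feature} (hF : Feature.diff ∉ F)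
    {e : Expr Λ} (he : e.InFrag F) :
    (eval e (bowtie Λ R)).Nonempty ↔ (eval e (clique3 Λ R)).Nonempty := by
  have hB := triangulated_bowtie R
  have hC := triangulated_clique3 R
  constructor
  · exact hC.nonempty_of_transfers ⟨0, hC.mem_adom_iff.2 (by simp [adj_clique3])⟩
      (hB.transfers_eval hF e he hC (transfers_bowtie_clique3 R) (transfers_clique3_bowtie R))
  · exact hB.nonempty_of_transfers ⟨0, hB.mem_adom_iff.2 (by simp [adj_bowtie])⟩
      (hC.transfers_eval hF e he hB (transfers_clique3_bowtie R) (transfers_bowtie_clique3 R))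

end Witnesses

theorem diff_mem_closure_iff {F : Set Feature} :
    Feature.diff ∈ closure F ↔ Feature.diff ∈ F := by
  refine ⟨fun h => ?_, InClosure.base⟩
  change InClosure F _ at h
  cases h
  assumption

theorem inFrag_rpow {Λ : Type} (F : Set Feature) (R : Λ) (n : ℕ) : (rpow R n).InFrag F := by
  induction n with
  | zero => trivial
  | succ n ih => exact ⟨trivial, ih⟩

theorem eval_rpow_one {Λ : Type} (R : Λ) (G : Graph Λ) : eval (rpow R 1) G = G R := by
  ext ⟨a, b⟩
  constructor
  · rintro ⟨z, h, hz : z = b, -⟩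
    exact hz ▸ h
  · exact fun h => ⟨b, h, rfl, a, R, Or.inr h⟩

theorem mem_eval_rpow_two {Λ : Type} (R : Λ) (G : Graph Λ) {a b : ℕ} :
    (a, b) ∈ eval (rpow R 2) G ↔ ∃ c, (a, c) ∈ G R ∧ (c, b) ∈ G R := by
  change (∃ c, (a, c) ∈ G R ∧ (c, b) ∈ eval (rpow R 1) G) ↔ _
  rw [eval_rpow_one]

/-- if `∖ ∈ F̄₁` and `∖ ∉ F̄₂` then `N(F₁)` is strongly separable
from `N(F₂)` at the level of boolean queries, witnessed by the bow-tie and the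
3-clique (with self-loops everywhere) and the boolean query expressed by
`R² ∖ R`. -/
theorem diff_separation (Λ : Type) [Fintype Λ] [Nonempty Λ] [DecidableEq Λ]
    (R : Λ) (F₁ F₂ : Set Feature)
    (h₁ : Feature.diff ∈ closure F₁) (h₂ : Feature.diff ∉ closure F₂) :
    (Expr.diff (rpow R 2) (rpow R 1)).InFrag F₁ ∧
    (eval (Expr.diff (rpow R 2) (rpow R 1)) (bowtie Λ R)).Nonempty ∧
    eval (Expr.diff (rpow R 2) (rpow R 1)) (clique3 Λ R) = ∅ ∧
    (∀ e₂ : Expr Λ, e₂.InFrag F₂ →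
      ((eval e₂ (bowtie Λ R)).Nonempty ↔ (eval e₂ (clique3 Λ R)).Nonempty)) ∧
    StrongSepBool Λ F₁ F₂ ∧ ¬ leqBool Λ F₁ F₂ := by
  rw [diff_mem_closure_iff] at h₁ h₂
  have hfrag : (Expr.diff (rpow R 2) (rpow R 1)).InFrag F₁ :=
    ⟨h₁, inFrag_rpow F₁ R 2, inFrag_rpow F₁ R 1⟩
  have hbow : (eval (Expr.diff (rpow R 2) (rpow R 1)) (bowtie Λ R)).Nonempty := by
    refine ⟨(0, 3), (mem_eval_rpow_two R _).2 ⟨2, ?_, ?_⟩, ?_⟩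
    · simp [mem_bowtie]
    · simp [mem_bowtie]
    · simp [eval_rpow_one, mem_bowtie]
  have hclique : eval (Expr.diff (rpow R 2) (rpow R 1)) (clique3 Λ R) = ∅ := by
    refine Set.sdiff_eq_empty.2 ?_
    rintro ⟨a, b⟩ h
    obtain ⟨c, hac, hcb⟩ := (mem_eval_rpow_two R _).1 h
    rw [eval_rpow_one]
    exact mem_clique3.2 ⟨rfl, (mem_clique3.1 hac).2.1, (mem_clique3.1 hcb).2.2⟩
  have hind : ∀ e₂ : Expr Λ, e₂.InFrag F₂ →
      ((eval e₂ (bowtie Λ R)).Nonempty ↔ (eval e₂ (clique3 Λ R)).Nonempty) :=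
    fun _ he => nonempty_eval_bowtie_iff R h₂ he
  have hsep : StrongSepBool Λ F₁ F₂ :=
    ⟨_, _, _, hfrag, bowtie_finite R, clique3_finite R, hbow, by simp [hclique], hind⟩
  exact ⟨hfrag, hbow, hclique, hind, hsep, hsep.not_leqBool⟩

end NavGraph
end
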